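/- arXiv:1608.01412 — 6 statements merged into one kernel-verified Lean document; each statement's English description precedes it below -/
import Mathlib

section
/- For positive integers n and k with 1 ≤ k ≤ n, E(2n,k) = Σ_{α₁+⋯+α_k=n, αᵢ≥1} ζ(2α₁,…,2α_k) = ((−1)^{n−k} π^{2n} / (2n+1)!) · Σ_{q=0}^{n−k} C(n−q, k) · C(2n+1, 2q) · 2^{2q} · B_{2q}(1/2), where B_j(x) denotes the j-th Bernoulli polynomial. -/
open Real Finset

/-- Multiple zeta value with real exponents `a i`, summed over
`1 ≤ k₁ < k₂ < ⋯ < k_r`. -/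
noncomputable def mzv {r : ℕ} (a : Fin r → ℝ) : ℝ :=
  ∑' f : {f : Fin r → ℕ // (∀ i, 1 ≤ f i) ∧ StrictMono f},
    ∏ i, ((f.1 i : ℝ)) ^ (-(a i))

/-- Multiple zeta star value with real exponents `a i`, summed over
`1 ≤ k₁ ≤ k₂ ≤ ⋯ ≤ k_r`. -/
noncomputable def mzsv {r : ℕ} (a : Fin r → ℝ) : ℝ :=
  ∑' f : {f : Fin r → ℕ // (∀ i, 1 ≤ f i) ∧ Monotone f},
    ∏ i, ((f.1 i : ℝ)) ^ (-(a i))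


/-- `E(mn,k)`: the sum of `ζ(mα₁,…,mα_k)` over all compositions `α` of `n`
into `k` positive parts. -/
noncomputable def Emn (m n k : ℕ) : ℝ :=
  ∑ α ∈ (Finset.Nat.antidiagonalTuple k n).filter (fun α => ∀ i, 1 ≤ α i),
    mzv (fun i => ((m * α i : ℕ) : ℝ))

open PowerSeries in
theorem one_sub_mul_geom (x : ℝ) :
    (1 - C x * X) * (PowerSeries.mk fun n => if n = 0 then 0 else x ^ n) = C x * (X : ℝ⟦X⟧) := by
  ext n
  rw [sub_mul, one_mul, mul_assoc, map_sub, coeff_C_mul, coeff_C_mul]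
  rcases n with _ | _ | n
  · simp
  · simp [coeff_succ_X_mul]
  · simp [coeff_succ_X_mul, coeff_X, pow_succ]
    ring

open PowerSeries in
/-- With `y i = x i * X / (1 - x i * X)`, the product of all `1 - x i * X` times the `k`-th elementary
symmetric function of the `y i` has coefficients `(-1) ^ (n + k) * n.choose k * eₙ(x)`. -/
theorem prod_mul_sum_geom {ι : Type*} (s : Finset ι) (x : ι → ℝ) (k : ℕ) :
    (∏ i ∈ s, (1 - C (x i) * X)) *
        ∑ t ∈ s.powersetCard k, ∏ i ∈ t, (PowerSeries.mk fun n => if n = 0 then 0 else x i ^ n) =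
      PowerSeries.mk fun n => (-1) ^ (n + k) * (n.choose k : ℝ) *
        ∑ t ∈ s.powersetCard n, ∏ i ∈ t, x i := by
  set y : ι → ℝ⟦X⟧ := fun i => PowerSeries.mk fun n => if n = 0 then 0 else x i ^ n with hy
  have key : Polynomial.C (∏ i ∈ s, (1 - C (x i) * X)) *
      ∏ i ∈ s, (1 + Polynomial.X * Polynomial.C (y i)) =
      ∏ i ∈ s, (1 + (Polynomial.X - 1) * Polynomial.C (C (x i) * (X : ℝ⟦X⟧))) := by
    rw [map_prod, ← prod_mul_distrib]
    refine prod_congr rfl fun i _ => ?_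
    have h := congrArg Polynomial.C (one_sub_mul_geom (x i))
    rw [Polynomial.C_mul] at h
    linear_combination (norm := (simp only [map_sub, map_mul, map_one, hy]; ring))
      Polynomial.X * h
  simp only [prod_one_add, prod_mul_distrib, prod_const, ← map_prod] at key
  have h := congrArg (fun p => Polynomial.coeff p k) key
  simp only [Polynomial.coeff_C_mul, Polynomial.finsetSum_coeff, Polynomial.coeff_mul_C] at h
  have h1 : ∀ t : Finset ι, (Polynomial.X ^ #t : Polynomial ℝ⟦X⟧).coeff k * ∏ i ∈ t, y i =
      if #t = k then ∏ i ∈ t, y i else 0 := by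
    intro t
    simp [Polynomial.coeff_X_pow, eq_comm]
  have h2 : ∀ t : Finset ι, ((Polynomial.X - 1) ^ #t : Polynomial ℝ⟦X⟧).coeff k =
      C ((-1) ^ (#t + k) * ((#t).choose k : ℝ)) := by
    intro t
    rw [← Polynomial.C_1, sub_eq_add_neg, ← Polynomial.C_neg, Polynomial.coeff_X_add_C_pow]
    rcases lt_or_ge (#t) k with hlt | hle
    · simp [Nat.choose_eq_zero_of_lt hlt]
    · obtain ⟨d, hd⟩ := Nat.exists_eq_add_of_le hle
      rw [hd, Nat.add_sub_cancel_left, show k + d + k = d + 2 * k by ring, pow_add, pow_mul]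
      simp
  simp only [h1, h2] at h
  rw [← sum_filter, ← powersetCard_eq_filter] at h
  rw [h]
  ext n
  simp only [map_sum, coeff_C_mul, coeff_mk]
  rw [powersetCard_eq_filter, sum_filter, mul_sum]
  refine sum_congr rfl fun t _ => ?_
  rcases eq_or_ne (#t) n with rfl | hne
  · simp
  · simp [hne, hne.symm]

theorem sum_strictMono_prod {R : Type*} [CommSemiring R] (s : Finset ℕ) (k : ℕ) (y : ℕ → R) :
    ∑ f ∈ (Fintype.piFinset fun _ : Fin k => s) with StrictMono f, ∏ i, y (f i) =
      ∑ t ∈ s.powersetCard k, ∏ i ∈ t, y i := by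
  classical
  refine sum_bij (fun f _ => univ.image f) ?_ ?_ ?_ ?_
  · intro f hf
    simp only [mem_filter, Fintype.mem_piFinset] at hf
    rw [mem_powersetCard]
    refine ⟨?_, ?_⟩
    · intro a ha
      obtain ⟨i, _, rfl⟩ := mem_image.1 ha
      exact hf.1 i
    · rw [card_image_of_injective _ hf.2.injective, card_univ, Fintype.card_fin]
  · intro f hf g hg h
    simp only [mem_filter, Fintype.mem_piFinset] at hf hg
    refine (StrictMono.range_inj hf.2 hg.2).1 ?_
    simpa using congrArg (fun u : Finset ℕ => (u : Set ℕ)) h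
  · intro t ht
    rw [mem_powersetCard] at ht
    refine ⟨t.orderEmbOfFin ht.2, ?_, ?_⟩
    · simp only [mem_filter, Fintype.mem_piFinset]
      exact ⟨fun i => ht.1 (t.orderEmbOfFin_mem ht.2 i), (t.orderEmbOfFin ht.2).strictMono⟩
    · exact image_orderEmbOfFin_univ t ht.2
  · intro f hf
    simp only [mem_filter] at hf
    rw [prod_image hf.2.injective.injOn]

open PowerSeries in
theorem coeff_prod_fin {R : Type*} [CommSemiring R] (k n : ℕ) (F : Fin k → R⟦X⟧) :
    coeff n (∏ i, F i) = ∑ α ∈ Finset.Nat.antidiagonalTuple k n, ∏ i, coeff (α i) (F i) := by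
  rw [coeff_prod]
  refine sum_bij (fun l _ => l) ?_ ?_ ?_ ?_
  · intro l hl
    simpa [Finset.Nat.mem_antidiagonalTuple] using hl
  · intro a _ b _ h
    exact DFunLike.coe_injective h
  · intro α hα
    refine ⟨Finsupp.equivFunOnFinite.symm α, ?_, rfl⟩
    simpa [Finset.Nat.mem_antidiagonalTuple] using hα
  · intro _ _
    rfl

open PowerSeries in
theorem coeff_sum_prod_geom (s : Finset ℕ) (x : ℕ → ℝ) (k n : ℕ) :
    coeff n (∑ t ∈ s.powersetCard k,
        ∏ i ∈ t, (PowerSeries.mk fun n => if n = 0 then 0 else x i ^ n)) =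
      ∑ α ∈ (Finset.Nat.antidiagonalTuple k n).filter (fun α => ∀ i, 1 ≤ α i),
        ∑ f ∈ (Fintype.piFinset fun _ : Fin k => s) with StrictMono f,
          ∏ i, x (f i) ^ α i := by
  rw [← sum_strictMono_prod, map_sum, sum_comm]
  refine sum_congr rfl fun f _ => ?_
  rw [coeff_prod_fin, sum_filter]
  refine sum_congr rfl fun α _ => ?_
  simp only [coeff_mk]
  split_ifs with h
  · exact prod_congr rfl fun i _ => if_neg (by have := h i; omega)
  · push Not at h
    obtain ⟨i, hi⟩ := h
    exact prod_eq_zero (mem_univ i) (if_pos (by omega))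
open Filter Topology

/-- Multiple zeta values at even positive arguments are limits of their truncations. -/
theorem tendsto_mzv {r : ℕ} (a : Fin r → ℕ) (ha : ∀ i, 1 ≤ a i) :
    Tendsto (fun N : ℕ => ∑ f ∈ (Fintype.piFinset fun _ : Fin r => Icc 1 N) with StrictMono f,
      ∏ i, (((f i : ℝ) ^ 2)⁻¹) ^ a i) atTop (𝓝 (mzv fun i => ((2 * a i : ℕ) : ℝ))) := by
  classical
  set p : (Fin r → ℕ) → Prop := fun f => (∀ i, 1 ≤ f i) ∧ StrictMono f with hp
  set g : (Fin r → ℕ) → ℝ := fun f => ∏ i, (((f i : ℝ) ^ 2)⁻¹) ^ a i with hg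
  have hg0 : ∀ f, 0 ≤ g f := fun f => prod_nonneg fun i _ => by positivity
  have hS : Summable fun i : ℕ => ((i : ℝ) ^ 2)⁻¹ := Real.summable_nat_pow_inv.2 (by norm_num)
  have hle : ∀ f : Fin r → ℕ, g f ≤ ∏ i, ((f i : ℝ) ^ 2)⁻¹ := by
    intro f
    refine prod_le_prod (fun i _ => by positivity) fun i _ => ?_
    refine pow_le_of_le_one (by positivity) ?_ (by have := ha i; omega)
    rcases Nat.eq_zero_or_pos (f i) with h | h
    · simp [h]
    · exact inv_le_one_of_one_le₀ (one_le_pow₀ (by exact_mod_cast h))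
  have hsum : Summable g := by
    refine summable_of_sum_le (c := (∑' i : ℕ, ((i : ℝ) ^ 2)⁻¹) ^ r) hg0 fun u => ?_
    set T : Finset ℕ := u.biUnion fun f => univ.image f with hT
    calc ∑ f ∈ u, g f ≤ ∑ f ∈ Fintype.piFinset fun _ : Fin r => T, ∏ i, ((f i : ℝ) ^ 2)⁻¹ := by
          refine (sum_le_sum fun f _ => hle f).trans ?_
          refine sum_le_sum_of_subset_of_nonneg ?_ fun f _ _ => prod_nonneg fun i _ => by positivity
          intro f hf
          rw [Fintype.mem_piFinset]
          intro i
          exact mem_biUnion.2 ⟨f, hf, mem_image_of_mem f (mem_univ i)⟩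
      _ = (∑ i ∈ T, ((i : ℝ) ^ 2)⁻¹) ^ r := by
          rw [← prod_univ_sum (fun _ : Fin r => T) fun _ i => ((i : ℝ) ^ 2)⁻¹]
          simp
      _ ≤ _ := by
          refine pow_le_pow_left₀ (sum_nonneg fun i _ => by positivity) ?_ r
          exact hS.sum_le_tsum _ fun i _ => by positivity
  have hmzv : mzv (fun i => ((2 * a i : ℕ) : ℝ)) = ∑' f : {f // p f}, g f.1 := by
    unfold mzv
    refine tsum_congr fun f => prod_congr rfl fun i _ => ?_
    rw [Real.rpow_neg (Nat.cast_nonneg _), Real.rpow_natCast, pow_mul, inv_pow]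
  rw [hmzv]
  have hs : Summable fun f : {f // p f} => g f.1 := hsum.subtype _
  have ht : Tendsto (fun N : ℕ => Finset.subtype p (Fintype.piFinset fun _ : Fin r => Icc 1 N))
      atTop atTop := by
    refine tendsto_atTop_finset_of_monotone ?_ ?_
    · intro M N hMN f hf
      simp only [mem_subtype, Fintype.mem_piFinset, mem_Icc] at hf ⊢
      exact fun i => ⟨(hf i).1, (hf i).2.trans hMN⟩
    · rintro ⟨f, hf⟩
      refine ⟨∑ i, f i, ?_⟩
      simp only [mem_subtype, Fintype.mem_piFinset, mem_Icc]
      exact fun i => ⟨hf.1 i, single_le_sum (f := f) (fun _ _ => Nat.zero_le _) (mem_univ i)⟩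
  refine (hs.hasSum.comp ht).congr fun N => ?_
  simp only [Function.comp]
  rw [sum_subtype_eq_sum_filter]
  refine sum_congr (filter_congr fun f hf => ?_) fun _ _ => rfl
  simp only [Fintype.mem_piFinset, mem_Icc] at hf
  exact ⟨fun h => h.2, fun h => ⟨fun i => (hf i).1, h⟩⟩

theorem tendsto_prod_one_sub_div_sq {e : ℕ → ℝ}
    (he : ∀ j, Tendsto (fun N : ℕ => ∑ t ∈ (Icc 1 N).powersetCard j, ∏ i ∈ t, ((i : ℝ) ^ 2)⁻¹)
      atTop (𝓝 (e j))) {y : ℂ} (hy : ‖y‖ < 1 / 2) :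
    Summable (fun j => (-y) ^ j * (e j : ℂ)) ∧
    Tendsto (fun N : ℕ => ∏ i ∈ Icc 1 N, (1 - y / (i : ℂ) ^ 2)) atTop
      (𝓝 (∑' j, (-y) ^ j * (e j : ℂ))) := by
  set x : ℕ → ℝ := fun i => ((i : ℝ) ^ 2)⁻¹ with hx
  have hx0 : ∀ i, 0 ≤ x i := fun i => by positivity
  have hS : Summable x := Real.summable_nat_pow_inv.2 (by norm_num)
  set M := Real.exp (∑' i, x i)
  set E : ℕ → ℕ → ℝ := fun N j => ∑ t ∈ (Icc 1 N).powersetCard j, ∏ i ∈ t, x i with hE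
  have hE0 : ∀ N j, 0 ≤ E N j := fun N j => sum_nonneg fun t _ => prod_nonneg fun i _ => hx0 i
  have hEM : ∀ N j, E N j ≤ M := by
    intro N j
    calc E N j ≤ ∑ t ∈ (Icc 1 N).powerset, ∏ i ∈ t, x i := by
          refine sum_le_sum_of_subset_of_nonneg ?_ fun t _ _ => prod_nonneg fun i _ => hx0 i
          rw [powersetCard_eq_filter]
          exact filter_subset _ _
      _ = ∏ i ∈ Icc 1 N, (1 + x i) := (prod_one_add _).symm
      _ ≤ Real.exp (∑ i ∈ Icc 1 N, x i) := Real.prod_one_add_le_exp_sum _ hx0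
      _ ≤ M := Real.exp_le_exp.2 (hS.sum_le_tsum _ fun i _ => hx0 i)
  have hbound : Summable fun j : ℕ => (1 / 2 : ℝ) ^ j * M :=
    (summable_geometric_of_lt_one (by norm_num) (by norm_num)).mul_right M
  have hb : ∀ N j, ‖(-y) ^ j * (E N j : ℂ)‖ ≤ (1 / 2 : ℝ) ^ j * M := by
    intro N j
    rw [norm_mul, norm_pow, norm_neg, Complex.norm_real, Real.norm_of_nonneg (hE0 N j)]
    gcongr
    exact hEM N j
  have hlim : ∀ j, Tendsto (fun N => (-y) ^ j * (E N j : ℂ)) atTop (𝓝 ((-y) ^ j * (e j : ℂ))) :=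
    fun j => ((Complex.continuous_ofReal.tendsto _).comp (he j)).const_mul _
  refine ⟨.of_norm_bounded hbound fun j => le_of_tendsto (hlim j).norm (.of_forall fun N => hb N j),
    ?_⟩
  refine (tendsto_tsum_of_dominated_convergence hbound hlim
    (.of_forall fun N j => hb N j)).congr fun N => ?_
  have hprod : ∏ i ∈ Icc 1 N, (1 - y / (i : ℂ) ^ 2) = ∏ i ∈ Icc 1 N, (1 + (-y) * (x i : ℂ)) := by
    refine prod_congr rfl fun i _ => ?_
    simp only [hx]
    push_cast
    ring
  rw [hprod, prod_one_add, sum_powerset, tsum_eq_sum (s := range (#(Icc 1 N) + 1))]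
  · refine sum_congr rfl fun j _ => ?_
    simp only [hE]
    push_cast
    rw [mul_sum]
    refine sum_congr rfl fun t ht => ?_
    rw [prod_mul_distrib, prod_const, (mem_powersetCard.1 ht).2]
  · intro j hj
    simp only [hE]
    rw [powersetCard_eq_empty.2 (by simpa using hj)]
    simp

/-- Comparing the Euler product of the sine with its Taylor series evaluates the elementary
symmetric functions of the inverse squares. -/
theorem tendsto_esymm_inv_sq_unique {e : ℕ → ℝ}
    (he : ∀ j, Tendsto (fun N : ℕ => ∑ t ∈ (Icc 1 N).powersetCard j, ∏ i ∈ t, ((i : ℝ) ^ 2)⁻¹)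
      atTop (𝓝 (e j))) (j : ℕ) :
    e j = π ^ (2 * j) / (2 * j + 1).factorial := by
  have h0 : e 0 = 1 := tendsto_nhds_unique (he 0) (by simp)
  have hval : ∀ y : ℂ, ‖y‖ < 1 / 2 → y ≠ 0 →
      HasSum (fun j => (-y) ^ j * ((π ^ (2 * j) / (2 * j + 1).factorial : ℝ) : ℂ))
        (∑' j, (-y) ^ j * (e j : ℂ)) := by
    intro y hy hy0
    obtain ⟨z, hz⟩ := IsAlgClosed.exists_pow_nat_eq y two_pos
    have hz0 : z ≠ 0 := by
      rintro rfl
      simp [hy0.symm] at hz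
    have hpz : (π : ℂ) * z ≠ 0 := mul_ne_zero (by exact_mod_cast Real.pi_ne_zero) hz0
    have h1 := ((tendsto_prod_one_sub_div_sq he hy).2).const_mul ((π : ℂ) * z)
    have h2 := Complex.tendsto_euler_sin_prod z
    have h3 : (π : ℂ) * z * ∑' j, (-y) ^ j * (e j : ℂ) = Complex.sin (π * z) := by
      refine tendsto_nhds_unique h1 (h2.congr fun N => ?_)
      congr 1
      have h := prod_Ico_add' (fun i : ℕ => 1 - y / (i : ℂ) ^ 2) 0 N 1
      rw [zero_add, Ico_add_one_right_eq_Icc] at h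
      rw [← h, range_eq_Ico]
      refine prod_congr rfl fun i _ => ?_
      rw [hz]
      push_cast
      rfl
    have h4 := (Complex.hasSum_sin (π * z)).mul_left ((π * z)⁻¹)
    rw [← h3, inv_mul_cancel_left₀ hpz] at h4
    refine HasSum.congr_fun h4 fun j => ?_
    rw [← hz]
    push_cast
    field_simp
    ring
  have hp : HasFPowerSeriesAt (fun y : ℂ => ∑' j, (-y) ^ j * (e j : ℂ))
      (.ofScalars ℂ fun j => (-1 : ℂ) ^ j * (e j : ℂ)) 0 := by
    rw [hasFPowerSeriesAt_iff]
    filter_upwards [Metric.ball_mem_nhds (0 : ℂ) (show (0 : ℝ) < 1 / 2 by norm_num)] with y hy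
    rw [mem_ball_zero_iff] at hy
    rw [zero_add]
    refine HasSum.congr_fun (tendsto_prod_one_sub_div_sq he hy).1.hasSum fun j => ?_
    rw [FormalMultilinearSeries.coeff_ofScalars, neg_pow, smul_eq_mul]
    ring
  have hq : HasFPowerSeriesAt (fun y : ℂ => ∑' j, (-y) ^ j * (e j : ℂ))
      (.ofScalars ℂ fun j => (-1 : ℂ) ^ j * ((π ^ (2 * j) / (2 * j + 1).factorial : ℝ) : ℂ)) 0 := by
    rw [hasFPowerSeriesAt_iff]
    filter_upwards [Metric.ball_mem_nhds (0 : ℂ) (show (0 : ℝ) < 1 / 2 by norm_num)] with y hy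
    rw [mem_ball_zero_iff] at hy
    rw [zero_add]
    have h : HasSum (fun j => (-y) ^ j * ((π ^ (2 * j) / (2 * j + 1).factorial : ℝ) : ℂ))
        (∑' j, (-y) ^ j * (e j : ℂ)) := by
      rcases eq_or_ne y 0 with rfl | hy0
      · have h1 : ∑' j, (-(0 : ℂ)) ^ j * (e j : ℂ) = 1 := by
          rw [tsum_eq_single 0 fun j hj => by simp [hj]]
          simp [h0]
        rw [h1]
        convert hasSum_single (f := fun j => (-(0 : ℂ)) ^ j *
          ((π ^ (2 * j) / (2 * j + 1).factorial : ℝ) : ℂ)) 0 fun j hj => by simp [hj]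
        simp
      · exact hval y hy hy0
    refine HasSum.congr_fun h fun j => ?_
    rw [FormalMultilinearSeries.coeff_ofScalars, neg_pow, smul_eq_mul]
    ring
  have h := congrArg (fun p => FormalMultilinearSeries.coeff p j) (hp.eq_formalMultilinearSeries hq)
  simp only [FormalMultilinearSeries.coeff_ofScalars] at h
  exact_mod_cast mul_left_cancel₀ (pow_ne_zero j (neg_ne_zero.2 one_ne_zero)) h
open PowerSeries in
/-- The power series of `sin √t / √t` and `√t / sin √t` (at `π ^ 2 * X`) are mutually inverse, the
latter having Bernoulli polynomials at `1 / 2` as coefficients. -/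
theorem sum_bernoulli_half_div_factorial (n : ℕ) :
    ∑ p ∈ antidiagonal n, ((-1) ^ p.1 * π ^ (2 * p.1) / (2 * p.1 + 1).factorial) *
      ((-1) ^ p.2 * π ^ (2 * p.2) / (2 * p.2).factorial * 2 ^ (2 * p.2) *
        (((Polynomial.bernoulli (2 * p.2)).eval ((1 : ℚ) / 2) : ℚ) : ℝ)) =
      if n = 0 then 1 else 0 := by
  set b : ℕ → ℚ := fun q => (Polynomial.bernoulli q).eval ((1 : ℚ) / 2) with hb
  have hgen := congrArg (rescale (2 : ℚ)) (Polynomial.bernoulli_generating_function (1 / 2 : ℚ))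
  set F : ℚ⟦X⟧ := rescale 2 (PowerSeries.mk fun n =>
    Polynomial.aeval (1 / 2 : ℚ) ((1 / n.factorial : ℚ) • Polynomial.bernoulli n)) with hF
  have hexp : rescale (2 : ℚ) (exp ℚ) = exp ℚ * exp ℚ := by
    have := exp_mul_exp_eq_exp_add (A := ℚ) 1 1
    rw [rescale_one] at this
    simpa [one_add_one_eq_two] using this.symm
  have hhalf : rescale (2 : ℚ) (rescale (1 / 2 : ℚ) (exp ℚ)) = exp ℚ := by
    rw [← RingHom.comp_apply, ← rescale_mul]
    norm_num [rescale_one]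
  have hneg := exp_mul_exp_neg_eq_one (A := ℚ)
  simp only [map_mul, map_sub, map_one, hexp, hhalf, rescale_X] at hgen
  have hsinh : F * (exp ℚ - evalNegHom (exp ℚ)) = C 2 * X := by
    linear_combination evalNegHom (exp ℚ) * hgen +
      (C 2 * (X : ℚ⟦X⟧) - F * exp ℚ) * hneg
  have hc := congrArg (coeff (2 * n + 1)) hsinh
  rw [coeff_mul, coeff_C_mul, coeff_X] at hc
  have hterm : ∀ p : ℕ × ℕ, coeff p.1 F * coeff p.2 (exp ℚ - evalNegHom (exp ℚ)) =
      2 ^ p.1 * b p.1 / p.1.factorial * ((1 - (-1) ^ p.2) / p.2.factorial) := by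
    intro p
    simp only [hF, evalNegHom, coeff_rescale, coeff_mk, coeff_exp, map_sub, hb]
    simp
    ring
  simp only [hterm] at hc
  have hsum : ∑ p ∈ antidiagonal n, 2 ^ (2 * p.2) * b (2 * p.2) / (2 * p.2).factorial *
      (2 / (2 * p.1 + 1).factorial) = if n = 0 then 2 else 0 := by
    trans ∑ p ∈ antidiagonal (2 * n + 1),
      2 ^ p.1 * b p.1 / p.1.factorial * ((1 - (-1) ^ p.2) / p.2.factorial)
    · refine sum_of_injOn (fun p => (2 * p.2, 2 * p.1 + 1)) ?_ ?_ ?_ ?_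
      · intro p _ q _ h
        simp only [Prod.mk.injEq] at h
        ext <;> omega
      · intro p hp
        simp only [mem_coe, HasAntidiagonal.mem_antidiagonal] at hp ⊢
        omega
      · rintro ⟨a, c⟩ hp hnot
        rw [HasAntidiagonal.mem_antidiagonal] at hp
        have hev : Even c := by
          by_contra hodd
          obtain ⟨d, rfl⟩ := Nat.not_even_iff_odd.1 hodd
          refine hnot ⟨(d, n - d), ?_, ?_⟩
          · simp at hp ⊢
            omega
          · simp at hp ⊢
            omega
        simp [hev.neg_one_pow]
      · intro p _
        simp [pow_succ, pow_mul]
        norm_num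
    · rw [hc]
      simp
  have hR := congrArg (fun z : ℚ => (z : ℝ)) hsum
  push_cast at hR
  trans (-1) ^ n * π ^ (2 * n) / 2 * ∑ p ∈ antidiagonal n,
    (2 : ℝ) ^ (2 * p.2) * (b (2 * p.2) : ℝ) / (2 * p.2).factorial * (2 / (2 * p.1 + 1).factorial)
  · rw [mul_sum]
    refine sum_congr rfl fun p hp => ?_
    rw [← HasAntidiagonal.mem_antidiagonal.1 hp]
    ring
  · rw [hR]
    rcases eq_or_ne n 0 with rfl | hn
    · simp
    · simp [hn]
theorem tendsto_esymm_inv_sq (j : ℕ) :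
    Tendsto (fun N : ℕ => ∑ t ∈ (Icc 1 N).powersetCard j, ∏ i ∈ t, ((i : ℝ) ^ 2)⁻¹)
      atTop (𝓝 (π ^ (2 * j) / (2 * j + 1).factorial)) := by
  have h : ∀ j : ℕ, Tendsto
      (fun N : ℕ => ∑ t ∈ (Icc 1 N).powersetCard j, ∏ i ∈ t, ((i : ℝ) ^ 2)⁻¹)
      atTop (𝓝 (mzv fun _ : Fin j => ((2 * 1 : ℕ) : ℝ))) := by
    intro j
    refine (tendsto_mzv (fun _ : Fin j => 1) fun _ => le_rfl).congr fun N => ?_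
    simp only [pow_one]
    exact sum_strictMono_prod _ j fun i => ((i : ℝ) ^ 2)⁻¹
  rw [← tendsto_esymm_inv_sq_unique h j]
  exact h j

/-- Convolution identity determining `Emn 2 n k` from the values `ζ(2, …, 2)`. -/
theorem sum_esymm_mul_Emn (n k : ℕ) :
    ∑ p ∈ antidiagonal n, ((-1) ^ p.1 * π ^ (2 * p.1) / (2 * p.1 + 1).factorial) * Emn 2 p.2 k =
      (-1) ^ (n + k) * (n.choose k : ℝ) * (π ^ (2 * n) / (2 * n + 1).factorial) := by
  set x : ℕ → ℝ := fun i => ((i : ℝ) ^ 2)⁻¹ with hx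
  have hE : ∀ b : ℕ, Tendsto (fun N : ℕ => PowerSeries.coeff b
      (∑ t ∈ (Icc 1 N).powersetCard k, ∏ i ∈ t,
        (PowerSeries.mk fun n => if n = 0 then 0 else x i ^ n))) atTop (𝓝 (Emn 2 b k)) := by
    intro b
    simp only [coeff_sum_prod_geom]
    exact tendsto_finsetSum _ fun α hα => tendsto_mzv α (mem_filter.1 hα).2
  have hA : ∀ s : Finset ℕ, ∏ i ∈ s, (1 - PowerSeries.C (x i) * PowerSeries.X) =
      PowerSeries.mk fun n => (-1) ^ n * ∑ t ∈ s.powersetCard n, ∏ i ∈ t, x i := by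
    intro s
    simpa using prod_mul_sum_geom s x 0
  simp only [mul_div_assoc]
  refine tendsto_nhds_unique
    (tendsto_finsetSum (antidiagonal n) fun p _ =>
      ((tendsto_esymm_inv_sq p.1).const_mul ((-1) ^ p.1)).mul (hE p.2)) ?_
  refine ((tendsto_esymm_inv_sq n).const_mul ((-1) ^ (n + k) * (n.choose k : ℝ))).congr
    fun N => ?_
  have h := congrArg (PowerSeries.coeff n) (prod_mul_sum_geom (Icc 1 N) x k)
  rw [hA, PowerSeries.coeff_mul] at h
  simp only [PowerSeries.coeff_mk] at h
  exact h.symm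

/-- Theorem B: for `1 ≤ k ≤ n`,
`E(2n,k) = ((-1)^{n-k} π^{2n}/(2n+1)!) Σ_{q=0}^{n-k} C(n-q,k) C(2n+1,2q) 2^{2q} B_{2q}(1/2)`. -/
theorem E_two_n_k (n k : ℕ) (hk : 1 ≤ k) (hkn : k ≤ n) :
    Emn 2 n k =
      (-1 : ℝ) ^ (n - k) * π ^ (2 * n) / (Nat.factorial (2 * n + 1)) *
        ∑ q ∈ Finset.range (n - k + 1),
          ((n - q).choose k : ℝ) * ((2 * n + 1).choose (2 * q)) * 2 ^ (2 * q) *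
            (((Polynomial.bernoulli (2 * q)).eval ((1 : ℚ) / 2) : ℚ) : ℝ) := by
  set A : PowerSeries ℝ := PowerSeries.mk fun j =>
    (-1) ^ j * π ^ (2 * j) / (2 * j + 1).factorial with hA
  set B : PowerSeries ℝ := PowerSeries.mk fun q =>
    (-1) ^ q * π ^ (2 * q) / (2 * q).factorial * 2 ^ (2 * q) *
      (((Polynomial.bernoulli (2 * q)).eval ((1 : ℚ) / 2) : ℚ) : ℝ) with hB
  have hAB : A * B = 1 := by
    ext m
    rw [PowerSeries.coeff_mul, PowerSeries.coeff_one, ← sum_bernoulli_half_div_factorial]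
    simp only [hA, hB, PowerSeries.coeff_mk]
  have hAE : A * PowerSeries.mk (fun m => Emn 2 m k) = PowerSeries.mk fun m =>
      (-1) ^ (m + k) * (m.choose k : ℝ) * (π ^ (2 * m) / (2 * m + 1).factorial) := by
    ext m
    rw [PowerSeries.coeff_mul, PowerSeries.coeff_mk, ← sum_esymm_mul_Emn]
    simp only [hA, PowerSeries.coeff_mk]
  have hE : PowerSeries.mk (fun m => Emn 2 m k) = B * PowerSeries.mk fun m =>
      (-1) ^ (m + k) * (m.choose k : ℝ) * (π ^ (2 * m) / (2 * m + 1).factorial) := by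
    rw [← hAE]
    linear_combination -PowerSeries.mk (fun m => Emn 2 m k) * hAB
  have h := congrArg (PowerSeries.coeff n) hE
  rw [PowerSeries.coeff_mul, Finset.Nat.sum_antidiagonal_eq_sum_range_succ_mk,
    PowerSeries.coeff_mk] at h
  simp only [hB, PowerSeries.coeff_mk] at h
  rw [h, mul_sum]
  symm
  refine sum_subset_zero_on_sdiff (range_subset_range.2 (by omega)) ?_ ?_
  · intro q hq
    simp only [Finset.mem_sdiff, Finset.mem_range] at hq
    rw [Nat.choose_eq_zero_of_lt (by omega : n - q < k)]
    simp
  · intro q hq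
    rw [mem_range] at hq
    obtain ⟨d, rfl⟩ := Nat.exists_eq_add_of_le (by omega : q + k ≤ n)
    rw [show q + k + d - q = k + d by omega, show q + k + d - k = q + d by omega,
      Nat.cast_choose ℝ (by omega : 2 * q ≤ 2 * (q + k + d) + 1),
      show 2 * (q + k + d) + 1 - 2 * q = 2 * (k + d) + 1 by omega,
      show k + d + k = d + 2 * k by ring, pow_add _ d, pow_mul _ 2 k]
    field_simp
    ring
end

section
/- Let m ≥ 3 be an odd positive integer, n a positive integer, and w = e^{2πi/m}. Then ζ({2m}^n) = (2·(2π)^{2mn} / (2mn+m)!) · Σ_{r=1}^{(m−1)/2} (−1)^{r−1} Σ_{0≤j₁<j₂<⋯<j_r≤m−1} (w^{j₁} + w^{j₂} + ⋯ + w^{j_r})^{2mn+m}. -/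
open Real Finset

/-- The coefficients of an everywhere convergent complex power series are determined by its sum. -/
lemma eq_of_forall_hasSum_mul_pow {a b : ℕ → ℂ} {f : ℂ → ℂ}
    (ha : ∀ z, HasSum (fun n => a n * z ^ n) (f z))
    (hb : ∀ z, HasSum (fun n => b n * z ^ n) (f z)) : a = b := by
  have key (c : ℕ → ℂ) (hc : ∀ z, HasSum (fun n => c n * z ^ n) (f z)) :
      HasFPowerSeriesAt f (FormalMultilinearSeries.ofScalars ℂ c) 0 := by
    rw [hasFPowerSeriesAt_iff]
    refine Filter.Eventually.of_forall fun z => ?_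
    simpa [FormalMultilinearSeries.coeff_ofScalars, mul_comm] using hc z
  exact FormalMultilinearSeries.ofScalars_series_injective ℂ ℂ
    ((key a ha).eq_formalMultilinearSeries (key b hb))

/-- The power series in `y` of `∏ (1 + y a_i)`, whose coefficients are the infinite elementary
symmetric sums of `a`. -/
lemma hasSum_pow_mul_tsum_powersetCard {a : ℕ → ℂ} (ha : Summable (‖a ·‖)) (y : ℂ) :
    HasSum (fun n => y ^ n * ∑' s : Set.powersetCard ℕ n, ∏ i ∈ s.1, a i)
      (∏' i, (1 + y * a i)) := by
  have hsum : Summable fun s : Finset ℕ => ∏ i ∈ s, (y * a i) :=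
    summable_finsetProd_of_summable_norm (by simpa using ha.mul_left ‖y‖)
  rw [tprod_one_add hsum]
  have hsig := ((Equiv.sigmaFiberEquiv (Finset.card : Finset ℕ → ℕ)).hasSum_iff).mpr hsum.hasSum
  have hfib := hsig.sigma fun n => (hsig.summable.sigma_factor n).hasSum
  convert hfib using 2 with n
  rw [← tsum_mul_left]
  refine tsum_congr fun s => ?_
  have hs : s.1.card = n := s.2
  change _ = ∏ i ∈ s.1, (y * a i)
  rw [Finset.prod_mul_distrib, Finset.prod_const, hs]

/-- Strictly increasing tuples of positive integers correspond to finite sets of naturals. -/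
def strictMonoPosEquivPowersetCard (n : ℕ) :
    {f : Fin n → ℕ // (∀ i, 1 ≤ f i) ∧ StrictMono f} ≃ Set.powersetCard ℕ n :=
  Equiv.trans
    { toFun f := OrderEmbedding.ofStrictMono (fun i => f.1 i - 1) fun i j hij => by
        have h₁ := f.2.1 i
        have h₂ := f.2.2 hij
        change f.1 i - 1 < f.1 j - 1
        omega
      invFun g := ⟨fun i => g i + 1, fun i => Nat.le_add_left 1 _, fun i j hij =>
        Nat.add_lt_add_right (g.strictMono hij) 1⟩
      left_inv f := by
        ext i
        exact Nat.sub_add_cancel (f.2.1 i)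
      right_inv g := by
        ext i
        exact Nat.add_sub_cancel _ _ }
    Set.powersetCard.ofFinEmbEquiv

lemma mzv_const_eq_tsum_powersetCard (n k : ℕ) :
    (mzv (fun _ : Fin n => (k : ℝ)) : ℂ) =
      ∑' s : Set.powersetCard ℕ n, ∏ i ∈ s.1, ((((i : ℂ) + 1) ^ k)⁻¹) := by
  rw [mzv, Complex.ofReal_tsum, ← (strictMonoPosEquivPowersetCard n).symm.tsum_eq]
  refine tsum_congr fun s => ?_
  have hs : s.1.card = n := s.2
  have himage : Finset.image (s.1.orderEmbOfFin hs) Finset.univ = s.1 :=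
    Finset.image_orderEmbOfFin_univ s.1 hs
  conv_rhs => rw [← himage]
  rw [Finset.prod_image fun i _ j _ h => (s.1.orderEmbOfFin hs).injective h, Complex.ofReal_prod]
  refine Finset.prod_congr rfl fun i _ => ?_
  change ((((s.1.orderEmbOfFin hs i + 1 : ℕ) : ℝ) ^ (-(k : ℝ)) : ℝ) : ℂ) = _
  rw [Real.rpow_neg (Nat.cast_nonneg _), Real.rpow_natCast]
  push_cast
  rfl

lemma prod_nthRootsFinset_eq_prod_range {m : ℕ} {w : ℂ} (hw : IsPrimitiveRoot w m) (f : ℂ → ℂ) :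
    ∏ ζ ∈ Polynomial.nthRootsFinset m (1 : ℂ), f ζ = ∏ j ∈ Finset.range m, f (w ^ j) := by
  classical
  have hval : (Polynomial.nthRootsFinset m (1 : ℂ)).val = Polynomial.nthRoots m (1 : ℂ) := by
    rw [Polynomial.nthRootsFinset_def, Multiset.toFinset_val,
      Multiset.dedup_eq_self.mpr hw.nthRoots_one_nodup]
  rw [Finset.prod_eq_multiset_prod, hval, hw.nthRoots_eq (one_pow m), Multiset.map_map]
  simp [Finset.prod_eq_multiset_prod]

lemma prod_primitiveRoot_pow_of_odd {m : ℕ} (hm : Odd m) {w : ℂ} (hw : IsPrimitiveRoot w m) :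
    ∏ j ∈ Finset.range m, w ^ j = 1 := by
  have h := hw.pow_add_pow_eq_prod_add_mul 0 1 hm
  rw [prod_nthRootsFinset_eq_prod_range hw fun ζ => 0 + ζ * 1] at h
  simpa [hm.pos.ne'] using h.symm

lemma one_sub_pow_two_mul_eq_prod {m : ℕ} (hm : Odd m) {w : ℂ} (hw : IsPrimitiveRoot w m)
    (u : ℂ) : 1 - u ^ (2 * m) = ∏ j ∈ Finset.range m, (1 - (w ^ j * u) ^ 2) := by
  have hsub := hw.pow_sub_pow_eq_prod_sub_mul 1 u hm.pos
  have hadd := hw.pow_add_pow_eq_prod_add_mul 1 u hm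
  rw [prod_nthRootsFinset_eq_prod_range hw fun ζ => 1 - ζ * u] at hsub
  rw [prod_nthRootsFinset_eq_prod_range hw fun ζ => 1 + ζ * u] at hadd
  calc 1 - u ^ (2 * m) = (1 ^ m - u ^ m) * (1 ^ m + u ^ m) := by rw [one_pow]; ring
    _ = _ := by
      rw [hsub, hadd, ← Finset.prod_mul_distrib]
      exact Finset.prod_congr rfl fun j _ => by ring

lemma summable_norm_inv_succ_pow {k : ℕ} (hk : 1 < k) :
    Summable fun i : ℕ => ‖(((i : ℂ) + 1) ^ k)⁻¹‖ := by
  have h := (summable_nat_add_iff 1).mpr (Real.summable_nat_pow_inv.mpr hk)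
  refine h.congr fun i => ?_
  rw [norm_inv, norm_pow]
  norm_cast

/-- Euler's product for `∏ sin (π w^j z)` over the `m`-th roots of unity, `m` odd. -/
lemma prod_sin_primitiveRoot_eq_tprod {m : ℕ} (hm : Odd m) {w : ℂ} (hw : IsPrimitiveRoot w m)
    (z : ℂ) :
    ∏ j ∈ Finset.range m, Complex.sin (π * (w ^ j * z)) =
      (π * z) ^ m * ∏' i : ℕ, (1 + -z ^ (2 * m) * (((i : ℂ) + 1) ^ (2 * m))⁻¹) := by
  have hprod : Multipliable fun i : ℕ => 1 + -z ^ (2 * m) * (((i : ℂ) + 1) ^ (2 * m))⁻¹ := by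
    refine multipliable_one_add_of_summable ?_
    have h := (summable_norm_inv_succ_pow (k := 2 * m) (by have := hm.pos; omega)).mul_left
      ‖-z ^ (2 * m)‖
    simpa only [norm_mul] using h
  refine tendsto_nhds_unique
    (tendsto_finsetProd _ fun j _ => Complex.tendsto_euler_sin_prod (w ^ j * z)) ?_
  refine (hprod.hasProd.tendsto_prod_nat.const_mul ((π * z) ^ m)).congr fun N => ?_
  rw [Finset.prod_mul_distrib, Finset.prod_comm]
  congr 1
  · simp only [Finset.prod_mul_distrib, prod_primitiveRoot_pow_of_odd hm hw, Finset.prod_const,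
      Finset.card_range]
    ring
  · refine Finset.prod_congr rfl fun i _ => ?_
    have h := one_sub_pow_two_mul_eq_prod hm hw (z / (i + 1))
    rw [div_pow] at h
    rw [neg_mul, ← sub_eq_add_neg, ← div_eq_mul_inv, h]
    exact Finset.prod_congr rfl fun j _ => by rw [← mul_div_assoc, div_pow]

/-- A product of sines of arguments with vanishing sum, as a sum of exponentials. -/
lemma prod_sin_eq_sum_powerset_exp {ι : Type*} [DecidableEq ι] (s : Finset ι) (v : ι → ℂ)
    (hv : ∑ j ∈ s, v j = 0) :
    ∏ j ∈ s, Complex.sin (v j) =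
      (Complex.I / 2) ^ s.card *
        ∑ t ∈ s.powerset, (-1) ^ t.card * Complex.exp (2 * Complex.I * ∑ j ∈ t, v j) := by
  have hsin (j : ι) : Complex.sin (v j) =
      (-1 * (Complex.I / 2)) * Complex.exp (Complex.I * v j) +
        (Complex.I / 2) * Complex.exp (-(Complex.I * v j)) := by
    rw [Complex.sin, mul_comm Complex.I (v j), neg_mul]
    ring
  simp_rw [hsin]
  rw [Finset.prod_add, Finset.mul_sum]
  refine Finset.sum_congr rfl fun t ht => ?_
  have hts := Finset.mem_powerset.mp ht
  have hsum : ∑ j ∈ s \ t, v j = -∑ j ∈ t, v j := by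
    rw [eq_neg_iff_add_eq_zero, Finset.sum_sdiff hts, hv]
  have hcard : s.card = t.card + (s \ t).card := by
    rw [add_comm, Finset.card_sdiff_add_card_eq_card hts]
  simp only [Finset.prod_mul_distrib, Finset.prod_const, ← Complex.exp_sum]
  rw [Finset.sum_neg_distrib, ← Finset.mul_sum, ← Finset.mul_sum, hsum, hcard, pow_add,
    two_mul, add_mul, Complex.exp_add]
  rw [mul_neg, neg_neg]
  ring

lemma hasSum_prod_sin_primitiveRoot {m : ℕ} (hm : 1 < m) {w : ℂ} (hw : IsPrimitiveRoot w m)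
    (z : ℂ) :
    HasSum (fun N : ℕ => ((Complex.I / 2) ^ m * ((2 * π * Complex.I) ^ N / N.factorial) *
        ∑ t ∈ (Finset.range m).powerset, (-1) ^ t.card * (∑ j ∈ t, w ^ j) ^ N) * z ^ N)
      (∏ j ∈ Finset.range m, Complex.sin (π * (w ^ j * z))) := by
  have hv : ∑ j ∈ Finset.range m, (π : ℂ) * (w ^ j * z) = 0 := by
    rw [← Finset.mul_sum, ← Finset.sum_mul, hw.geom_sum_eq_zero hm]
    simp
  rw [prod_sin_eq_sum_powerset_exp _ _ hv, Finset.card_range]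
  have h := (hasSum_sum fun t (_ : t ∈ (Finset.range m).powerset) =>
    (NormedSpace.expSeries_div_hasSum_exp
      (2 * Complex.I * ∑ j ∈ t, (π : ℂ) * (w ^ j * z))).mul_left ((-1) ^ t.card)).mul_left
      ((Complex.I / 2) ^ m)
  simp only [← Complex.exp_eq_exp_ℂ] at h
  refine h.congr_fun fun N => ?_
  rw [mul_assoc, mul_assoc, Finset.sum_mul, Finset.mul_sum]
  congr 1
  refine Finset.sum_congr rfl fun t _ => ?_
  rw [← Finset.mul_sum, ← Finset.sum_mul]
  simp only [mul_pow]
  ring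

/-- Pairing each subset with its complement. -/
lemma sum_powersetCard_sub_eq {s : Finset ℕ} {v : ℕ → ℂ} (hv : ∑ j ∈ s, v j = 0)
    {N r : ℕ} (hN : Odd N) (hr : r ≤ s.card) :
    ∑ t ∈ s.powersetCard (s.card - r), (∑ j ∈ t, v j) ^ N =
      -∑ t ∈ s.powersetCard r, (∑ j ∈ t, v j) ^ N := by
  rw [← Finset.sum_neg_distrib]
  refine Finset.sum_nbij' (s \ ·) (s \ ·) ?_ ?_ ?_ ?_ ?_
  · intro t ht
    rw [Finset.mem_powersetCard] at ht ⊢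
    exact ⟨Finset.sdiff_subset, by rw [Finset.card_sdiff_of_subset ht.1]; omega⟩
  · intro t ht
    rw [Finset.mem_powersetCard] at ht ⊢
    exact ⟨Finset.sdiff_subset, by rw [Finset.card_sdiff_of_subset ht.1, ht.2]⟩
  · intro t ht
    exact Finset.sdiff_sdiff_eq_self (Finset.mem_powersetCard.mp ht).1
  · intro t ht
    exact Finset.sdiff_sdiff_eq_self (Finset.mem_powersetCard.mp ht).1
  · intro t ht
    have h := Finset.sum_sdiff (f := v) (Finset.mem_powersetCard.mp ht).1
    rw [hv] at h
    rw [← hN.neg_pow, ← eq_neg_of_add_eq_zero_right h]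

lemma sum_powerset_neg_one_pow_mul_sum_pow {m : ℕ} (hm : Odd m) {v : ℕ → ℂ}
    (hv : ∑ j ∈ Finset.range m, v j = 0) {N : ℕ} (hN : Odd N) :
    ∑ t ∈ (Finset.range m).powerset, (-1) ^ t.card * (∑ j ∈ t, v j) ^ N =
      -(2 * ∑ r ∈ Finset.Icc 1 ((m - 1) / 2), (-1 : ℂ) ^ (r - 1) *
        ∑ t ∈ (Finset.range m).powersetCard r, (∑ j ∈ t, v j) ^ N) := by
  set G : ℕ → ℂ := fun r =>
    (-1) ^ r * ∑ t ∈ (Finset.range m).powersetCard r, (∑ j ∈ t, v j) ^ N with hG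
  have hall : ∑ t ∈ (Finset.range m).powerset, (-1) ^ t.card * (∑ j ∈ t, v j) ^ N =
      ∑ r ∈ Finset.range (m + 1), G r := by
    rw [Finset.sum_powerset, Finset.card_range]
    refine Finset.sum_congr rfl fun r _ => ?_
    simp only [hG, Finset.mul_sum]
    exact Finset.sum_congr rfl fun t ht => by rw [(Finset.mem_powersetCard.mp ht).2]
  have hsymm (r : ℕ) (hr : r ≤ m) : G (m - r) = G r := by
    have h := sum_powersetCard_sub_eq hv hN (r := r) (by simpa using hr)
    rw [Finset.card_range] at h
    have hsign : (-1 : ℂ) ^ (m - r) = -(-1) ^ r := by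
      rcases Nat.even_or_odd r with h' | h'
      · rw [(Nat.Odd.sub_even hr hm h').neg_one_pow, h'.neg_one_pow]
      · rw [(Nat.Odd.sub_odd hm h').neg_one_pow, h'.neg_one_pow, neg_neg]
    simp only [hG, h, hsign]
    ring
  have hzero : G 0 = 0 := by simp [hG, hN.pos.ne']
  obtain ⟨k, rfl⟩ := hm
  have hhalf : (2 * k + 1 - 1) / 2 = k := by omega
  have hupper : ∑ r ∈ Finset.range (k + 1), G (k + 1 + r) = ∑ r ∈ Finset.range (k + 1), G r := by
    rw [← Finset.sum_range_reflect G]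
    refine Finset.sum_congr rfl fun r hr => ?_
    rw [Finset.mem_range] at hr
    rw [← hsymm (k + 1 - 1 - r) (by omega)]
    congr 1
    omega
  have hIcc : ∑ r ∈ Finset.Icc 1 k, (-1 : ℂ) ^ (r - 1) *
      ∑ t ∈ (Finset.range (2 * k + 1)).powersetCard r, (∑ j ∈ t, v j) ^ N =
        -∑ r ∈ Finset.range (k + 1), G r := by
    rw [Finset.sum_range_succ', hzero, add_zero, ← Finset.sum_neg_distrib,
      ← Finset.Ico_add_one_right_eq_Icc, Finset.sum_Ico_eq_sum_range]
    refine Finset.sum_congr rfl fun r _ => ?_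
    rw [add_comm 1 r, Nat.add_sub_cancel, hG]
    ring
  rw [hall, hhalf, hIcc, show 2 * k + 1 + 1 = (k + 1) + (k + 1) by ring, Finset.sum_range_add,
    hupper]
  ring

/-- The power series of `∏ sin (π w^j z)`, with coefficients `ζ({2m}^n)`. -/
lemma hasSum_mzv_prod_sin_primitiveRoot {m : ℕ} (hm : Odd m) {w : ℂ} (hw : IsPrimitiveRoot w m)
    (z : ℂ) :
    HasSum (fun n : ℕ => (π ^ m * (-1) ^ n * (mzv (fun _ : Fin n => ((2 * m : ℕ) : ℝ)) : ℂ)) *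
        z ^ (2 * m * n + m))
      (∏ j ∈ Finset.range m, Complex.sin (π * (w ^ j * z))) := by
  rw [prod_sin_primitiveRoot_eq_tprod hm hw]
  have h := (hasSum_pow_mul_tsum_powersetCard
    (summable_norm_inv_succ_pow (k := 2 * m) (by have := hm.pos; omega))
    (-z ^ (2 * m))).mul_left ((π * z) ^ m)
  refine h.congr_fun fun n => ?_
  rw [mzv_const_eq_tsum_powersetCard, neg_pow, mul_pow, pow_add, pow_mul z (2 * m) n]
  ring

/-- For odd `m ≥ 3` and `w = e^{2πi/m}`,
`ζ({2m}^n) = (2 (2π)^{2mn}/(2mn+m)!) Σ_{r=1}^{(m-1)/2} (-1)^{r-1}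
  Σ_{0 ≤ j₁ < ⋯ < j_r ≤ m-1} (w^{j₁} + ⋯ + w^{j_r})^{2mn+m}`. -/
theorem zeta_two_m_rep_odd (m n : ℕ) (hm : 3 ≤ m) (hmo : Odd m) (hn : 1 ≤ n)
    (w : ℂ) (hw : w = Complex.exp (2 * π * Complex.I / m)) :
    (mzv (fun _ : Fin n => ((2 * m : ℕ) : ℝ)) : ℂ) =
      2 * (2 * π) ^ (2 * m * n) / (Nat.factorial (2 * m * n + m)) *
        ∑ r ∈ Finset.Icc 1 ((m - 1) / 2),
          (-1 : ℂ) ^ (r - 1) *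
            ∑ S ∈ (Finset.range m).powersetCard r,
              (∑ j ∈ S, w ^ j) ^ (2 * m * n + m) := by
  have hprim : IsPrimitiveRoot w m := hw ▸ Complex.isPrimitiveRoot_exp m (by omega)
  have hinj : Function.Injective fun k : ℕ => 2 * m * k + m := fun i j hij =>
    Nat.eq_of_mul_eq_mul_left (show 0 < 2 * m by omega) (Nat.add_right_cancel hij)
  set c : ℕ → ℂ := fun k =>
    π ^ m * (-1) ^ k * (mzv (fun _ : Fin k => ((2 * m : ℕ) : ℝ)) : ℂ) with hc
  have hseries (z : ℂ) :
      HasSum (fun N => Function.extend (fun k : ℕ => 2 * m * k + m) c 0 N * z ^ N)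
        (∏ j ∈ Finset.range m, Complex.sin (π * (w ^ j * z))) := by
    refine (hinj.hasSum_iff fun N hN => ?_).mp ?_
    · rw [Function.extend_apply' _ _ _ (by simpa using hN), Pi.zero_apply, zero_mul]
    · convert hasSum_mzv_prod_sin_primitiveRoot hmo hprim z using 2 with k
      simp only [Function.comp_apply, hinj.extend_apply, hc]
  have hcoeff := congrFun (eq_of_forall_hasSum_mul_pow hseries
    (hasSum_prod_sin_primitiveRoot (by omega) hprim)) (2 * m * n + m)
  have hodd : Odd (2 * m * n + m) := ((even_two_mul m).mul_right n).add_odd hmo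
  rw [hinj.extend_apply, sum_powerset_neg_one_pow_mul_sum_pow hmo
    (hprim.geom_sum_eq_zero (by omega)) hodd] at hcoeff
  have hI : Complex.I ^ m * Complex.I ^ (2 * m * n + m) = -(-1) ^ n := by
    rw [← pow_add, show m + (2 * m * n + m) = 2 * (m * n + m) by ring, pow_mul, Complex.I_sq,
      pow_add, pow_mul, hmo.neg_one_pow]
    ring
  have hpi : (π : ℂ) ^ m * (-1) ^ n ≠ 0 := by
    simp [Real.pi_ne_zero]
  refine mul_left_cancel₀ hpi (hcoeff.trans ?_)
  rw [div_pow, mul_pow (2 * (π : ℂ)), pow_add (2 * (π : ℂ)), mul_pow 2 (π : ℂ) m]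
  have h2 : (2 : ℂ) ^ m ≠ 0 := by simp
  field_simp
  linear_combination -(∑ r ∈ Finset.Icc 1 ((m - 1) / 2), (-1 : ℂ) ^ (r - 1) *
    ∑ S ∈ (Finset.range m).powersetCard r, (∑ j ∈ S, w ^ j) ^ (2 * m * n + m)) /
      (2 * m * n + m).factorial * hI
end

section
/- For every positive integer n, ζ({6}^n) = 6·(2π)^{6n} / (6n+3)!. -/
open Real Finset

/-- Finite sets of naturals of cardinality `n` correspond to strictly increasing sequences of `n`
positive integers, by listing the successors of their elements in order. -/
noncomputable def finsetCardEquivStrictMono (n : ℕ) :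
    {s : Finset ℕ // s.card = n} ≃ {f : Fin n → ℕ // (∀ i, 1 ≤ f i) ∧ StrictMono f} where
  toFun s := ⟨fun i => s.1.orderEmbOfFin s.2 i + 1, fun i => Nat.le_add_left _ _,
    fun _ _ h => Nat.add_lt_add_right ((s.1.orderEmbOfFin s.2).strictMono h) 1⟩
  invFun f := ⟨univ.image fun i => f.1 i - 1, by
    rw [card_image_of_injective, card_univ, Fintype.card_fin]
    intro i j h
    have hi := f.2.1 i
    have hj := f.2.1 j
    exact f.2.2.injective (by grind)⟩
  left_inv s := by
    ext1
    simp
  right_inv f := by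
    ext i
    have h := orderEmbOfFin_unique (s := univ.image fun i => f.1 i - 1) (k := n)
      (f := fun i => f.1 i - 1)
      (by
        rw [card_image_of_injective, card_univ, Fintype.card_fin]
        intro i j h
        have hi := f.2.1 i
        have hj := f.2.1 j
        exact f.2.2.injective (by grind))
      (fun i => mem_image_of_mem _ (mem_univ i))
      (fun i j h => by
        have hi := f.2.1 i
        have hj := f.2.2 h
        grind)
    have hi := f.2.1 i
    have h' := congrFun h i
    simp only at h' ⊢
    rw [← h']
    omega

/-- `mzv` with constant arguments as an elementary symmetric sum over finite sets. -/
theorem mzv_const_eq_tsum_finset (n : ℕ) (a : ℝ) :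
    mzv (fun _ : Fin n => a) =
      ∑' s : {s : Finset ℕ // s.card = n}, ∏ i ∈ s.1, ((i : ℝ) + 1) ^ (-a) := by
  rw [mzv, ← (finsetCardEquivStrictMono n).tsum_eq]
  refine tsum_congr fun s => ?_
  conv_rhs => rw [← map_orderEmbOfFin_univ s.1 s.2, prod_map]
  simp [finsetCardEquivStrictMono]

theorem hasSum_pow_mul_mzv_six (y : ℂ) :
    HasSum (fun n => y ^ n * (mzv (fun _ : Fin n => (6 : ℝ)) : ℂ))
      (∏' k : ℕ, (1 + y / ((k : ℂ) + 1) ^ 6)) := by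
  have hs : Summable fun k : ℕ => ‖y / ((k : ℂ) + 1) ^ 6‖ := by
    have h : Summable fun k : ℕ => 1 / ((k + 1 : ℕ) : ℝ) ^ 6 :=
      (summable_nat_add_iff 1).2 (Real.summable_one_div_nat_pow.2 (by norm_num))
    refine (h.mul_left ‖y‖).congr fun k => ?_
    rw [norm_div, norm_pow, ← Nat.cast_add_one, Complex.norm_natCast]
    ring
  have hf := summable_finsetProd_of_summable_norm hs
  have hsum := hf.hasSum
  rw [← tprod_one_add hf, ← (Equiv.sigmaFiberEquiv Finset.card).hasSum_iff] at hsum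
  refine hsum.sigma fun n => ?_
  refine (hsum.summable.sigma_factor n).hasSum_iff.2 ?_
  symm
  rw [mzv_const_eq_tsum_finset, Complex.ofReal_tsum, ← tsum_mul_left]
  refine tsum_congr fun s => ?_
  simp only [Function.comp_apply, Equiv.sigmaFiberEquiv, Equiv.coe_fn_mk, div_eq_mul_inv,
    prod_mul_distrib, prod_const, s.2, Complex.ofReal_prod]
  congr 1
  refine prod_congr rfl fun i _ => ?_
  rw [Real.rpow_neg (by positivity), Real.rpow_ofNat]
  push_cast
  rfl

theorem hasProd_one_add_sineTerm (x : ℂ) (hx : x ≠ 0) :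
    HasProd (fun k : ℕ => 1 + sineTerm x k) (Complex.sin (π * x) / (π * x)) := by
  rw [Multipliable.hasProd_iff_tendsto_nat (multipliable_sineTerm x)]
  exact tendsto_euler_sin_prod' hx

theorem Complex.sin_mul_sin_mul_sin_of_add_eq_zero {a b c : ℂ} (h : a + b + c = 0) :
    sin a * sin b * sin c = -(sin (2 * a) + sin (2 * b) + sin (2 * c)) / 4 := by
  obtain rfl : c = -(a + b) := by linear_combination h
  rw [mul_neg, sin_neg, sin_neg, sin_two_mul, sin_two_mul, sin_two_mul, sin_add, cos_add]
  have ha := sin_sq_add_cos_sq a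
  have hb := sin_sq_add_cos_sq b
  linear_combination (-(1 / 2) * (sin a * cos a)) * hb - (1 / 2) * (sin b * cos b) * ha

theorem hasSum_sin_add_sin_add_sin {ω : ℂ} (h : 1 + ω + ω ^ 2 = 0) (x : ℂ) :
    HasSum (fun n : ℕ => -(-1) ^ n * 3 * x ^ (6 * n + 3) / ((6 * n + 3).factorial : ℂ))
      (Complex.sin x + Complex.sin (ω * x) + Complex.sin (ω ^ 2 * x)) := by
  have h3 : ω ^ 3 = 1 := by linear_combination (ω - 1) * h
  have hs := ((Complex.hasSum_sin x).add (Complex.hasSum_sin (ω * x))).add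
    (Complex.hasSum_sin (ω ^ 2 * x))
  have hinj : Function.Injective fun n : ℕ => 3 * n + 1 := fun a b hab => by grind
  rw [← hinj.hasSum_iff] at hs
  · convert hs using 2 with n
    have h1 : (ω * x) ^ (6 * n + 3) = x ^ (6 * n + 3) := by
      rw [mul_pow, show 6 * n + 3 = 3 * (2 * n + 1) by ring, pow_mul ω, h3, one_pow, one_mul]
    have h2 : (ω ^ 2 * x) ^ (6 * n + 3) = x ^ (6 * n + 3) := by
      rw [mul_pow, ← pow_mul, show 2 * (6 * n + 3) = 3 * (4 * n + 2) by ring, pow_mul ω, h3,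
        one_pow, one_mul]
    have h4 : (-1 : ℂ) ^ (3 * n + 1) = -(-1) ^ n := by
      rw [pow_succ, pow_mul]
      norm_num
    simp only [Function.comp_apply, show 2 * (3 * n + 1) + 1 = 6 * n + 3 by ring, h1, h2, h4]
    ring
  · intro m hm
    have hsum : 1 + ω ^ (2 * m + 1) + (ω ^ 2) ^ (2 * m + 1) = 0 := by
      obtain ⟨q, rfl | rfl⟩ : ∃ q, m = 3 * q ∨ m = 3 * q + 2 := by
        refine ⟨m / 3, ?_⟩
        have : m % 3 ≠ 1 := fun hmod => hm ⟨m / 3, by simp only; omega⟩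
        omega
      · rw [← pow_mul, show 2 * (3 * q) + 1 = 3 * (2 * q) + 1 by ring,
          show 2 * (3 * (2 * q) + 1) = 3 * (4 * q) + 2 by ring, pow_add, pow_add,
          pow_mul ω 3 (2 * q), pow_mul ω 3 (4 * q), h3]
        linear_combination h
      · rw [← pow_mul, show 2 * (3 * q + 2) + 1 = 3 * (2 * q + 1) + 2 by ring,
          show 2 * (3 * (2 * q + 1) + 2) = 3 * (4 * q + 3) + 1 by ring, pow_add, pow_add, pow_mul,
          pow_mul, h3]
        linear_combination h
    simp only [mul_pow]
    linear_combination ((-1) ^ m * x ^ (2 * m + 1) / ((2 * m + 1).factorial : ℂ)) * hsum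

theorem hasSum_tprod_one_sub_pow_six {z : ℂ} (hz : z ≠ 0) :
    HasSum (fun n : ℕ => (-z ^ 6) ^ n * (6 * (2 * π) ^ (6 * n) / ((6 * n + 3).factorial : ℂ)))
      (∏' k : ℕ, (1 + -z ^ 6 / ((k : ℂ) + 1) ^ 6)) := by
  obtain ⟨ω, h⟩ : ∃ ω : ℂ, 1 + ω + ω ^ 2 = 0 := by
    have h := (Complex.isPrimitiveRoot_exp 3 (by norm_num)).geom_sum_eq_zero (by norm_num)
    exact ⟨_, by simpa [sum_range_succ] using h⟩
  have h3 : ω ^ 3 = 1 := by linear_combination (ω - 1) * h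
  have hω : ω ≠ 0 := by rintro rfl; simp at h3
  have hp := ((hasProd_one_add_sineTerm z hz).mul
    (hasProd_one_add_sineTerm (ω * z) (mul_ne_zero hω hz))).mul
    (hasProd_one_add_sineTerm (ω ^ 2 * z) (mul_ne_zero (pow_ne_zero 2 hω) hz))
  have hpi : (π : ℂ) ≠ 0 := by exact_mod_cast Real.pi_ne_zero
  have hprod : ∏' k : ℕ, (1 + -z ^ 6 / ((k : ℂ) + 1) ^ 6) =
      -(Complex.sin (2 * π * z) + Complex.sin (ω * (2 * π * z)) +
        Complex.sin (ω ^ 2 * (2 * π * z))) / (4 * π ^ 3 * z ^ 3) := by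
    have hs := Complex.sin_mul_sin_mul_sin_of_add_eq_zero (a := π * z) (b := π * (ω * z))
      (c := π * (ω ^ 2 * z)) (by linear_combination π * z * h)
    rw [show 2 * (π * z) = 2 * π * z by ring, show 2 * (π * (ω * z)) = ω * (2 * π * z) by ring,
      show 2 * (π * (ω ^ 2 * z)) = ω ^ 2 * (2 * π * z) by ring] at hs
    have he : ∀ k : ℕ, 1 + -z ^ 6 / ((k : ℂ) + 1) ^ 6 =
        (1 + sineTerm z k) * (1 + sineTerm (ω * z) k) * (1 + sineTerm (ω ^ 2 * z) k) := by
      intro k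
      simp only [sineTerm]
      generalize (k : ℂ) + 1 = K
      linear_combination (1 - ω + ω ^ 2) * (z ^ 2 / K ^ 2 -
        ω ^ 2 * (z ^ 2 / K ^ 2) ^ 2) * h +
        (ω ^ 3 + 1) * (z ^ 2 / K ^ 2) ^ 3 * h3
    rw [tprod_congr he, hp.tprod_eq, div_mul_div_comm, div_mul_div_comm, hs]
    rw [show π * z * (π * (ω * z)) * (π * (ω ^ 2 * z)) = (π : ℂ) ^ 3 * z ^ 3 by
      linear_combination π ^ 3 * z ^ 3 * h3]
    rw [div_div]
    ring
  rw [hprod]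
  refine ((hasSum_sin_add_sin_add_sin h (2 * π * z)).neg.div_const _).congr_fun fun n => ?_
  have hfac : ((6 * n + 3).factorial : ℂ) ≠ 0 := by exact_mod_cast Nat.factorial_ne_zero _
  rw [neg_pow (z ^ 6)]
  field_simp
  ring

theorem eq_of_hasSum_pow_mul {a b : ℕ → ℂ} {f : ℂ → ℂ}
    (ha : ∀ y, HasSum (fun n => y ^ n * a n) (f y))
    (hb : ∀ y, HasSum (fun n => y ^ n * b n) (f y)) : a = b := by
  have key : ∀ c : ℕ → ℂ, (∀ y, HasSum (fun n => y ^ n * c n) (f y)) →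
      HasFPowerSeriesAt f (FormalMultilinearSeries.ofScalars ℂ c) 0 := fun c hc => by
    rw [hasFPowerSeriesAt_iff]
    refine Filter.Eventually.of_forall fun y => ?_
    simpa [FormalMultilinearSeries.coeff_ofScalars] using hc y
  have h := (key a ha).eq_formalMultilinearSeries (key b hb)
  funext n
  simpa [FormalMultilinearSeries.coeff_ofScalars] using congrArg (fun p => p.coeff n) h

/-- `ζ({6}^n) = 6 (2π)^{6n}/(6n+3)!`. -/
theorem zeta_six_rep (n : ℕ) (hn : 1 ≤ n) :
    mzv (fun _ : Fin n => (6 : ℝ)) =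
      6 * (2 * π) ^ (6 * n) / (Nat.factorial (6 * n + 3)) := by
  have h := eq_of_hasSum_pow_mul hasSum_pow_mul_mzv_six
    (b := fun n => 6 * (2 * π) ^ (6 * n) / ((6 * n + 3).factorial : ℂ)) fun y => by
    rcases eq_or_ne y 0 with rfl | hy
    · convert hasSum_single 0 fun n hn => ?_ using 1
      · simp [Nat.factorial]
      · simp [hn]
    · obtain ⟨z, hz⟩ := IsAlgClosed.exists_pow_nat_eq (-y) (n := 6) (by norm_num)
      have hz0 : z ≠ 0 := by
        rintro rfl
        simp [eq_comm, hy] at hz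
      obtain rfl : y = -z ^ 6 := by rw [hz, neg_neg]
      exact hasSum_tprod_one_sub_pow_six hz0
  exact_mod_cast congrFun h n
end

section
/- For every positive integer n, ζ({12}^n) = (3·2^{6n−1} π^{12n} / (12n+6)!) · ( 2^{12n+6} + (√3 + 1)^{12n+6} + (√3 − 1)^{12n+6} ). -/
open Real Finset

theorem hasSum_of_forall_eq {ι : Type*} {f g : ι → ℂ} {x : ℂ} (h : ∀ i, f i = g i)
    (hg : HasSum g x) : HasSum f x := by
  rwa [funext h]

open Filter Topology in
/-- Two everywhere convergent complex power series with the same sum have the same coefficients. -/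
theorem eq_of_forall_hasSum_pow_mul {a b : ℕ → ℂ} {f : ℂ → ℂ}
    (ha : ∀ w, HasSum (fun k => w ^ k * a k) (f w))
    (hb : ∀ w, HasSum (fun k => w ^ k * b k) (f w)) : a = b := by
  have key : ∀ c : ℕ → ℂ, (∀ w, HasSum (fun k => w ^ k * c k) (f w)) →
      HasFPowerSeriesAt f (FormalMultilinearSeries.ofScalars ℂ c) 0 := by
    intro c hc
    rw [hasFPowerSeriesAt_iff]
    refine Eventually.of_forall fun w => ?_
    simpa [FormalMultilinearSeries.coeff_ofScalars] using hc w
  have h := (key a ha).eq_formalMultilinearSeries (key b hb)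
  ext k
  have := congrArg (fun p => FormalMultilinearSeries.coeff p k) h
  simpa [FormalMultilinearSeries.coeff_ofScalars] using this

/-- The generating function of the elementary symmetric functions of an absolutely summable
family. -/
theorem hasSum_pow_mul_tsum_prod {ι : Type*} {f : ι → ℂ} (hf : Summable fun i => ‖f i‖) (w : ℂ) :
    HasSum (fun n : ℕ => w ^ n * ∑' s : {s : Finset ι // s.card = n}, ∏ i ∈ s.1, f i)
      (∏' i, (1 + w * f i)) := by
  have hs : Summable fun i => ‖w * f i‖ := by
    simpa only [norm_mul] using hf.mul_left ‖w‖
  have h1 := summable_finsetProd_of_summable_norm hs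
  have h0 := summable_finsetProd_of_summable_norm hf
  rw [tprod_one_add h1]
  have h2 := (Equiv.sigmaFiberEquiv (Finset.card : Finset ι → ℕ)).hasSum_iff.mpr h1.hasSum
  refine h2.sigma fun n => ?_
  have h3 : Summable fun s : {s : Finset ι // s.card = n} => ∏ i ∈ s.1, f i :=
    h0.subtype {s | s.card = n}
  have h4 := h3.hasSum.mul_left (w ^ n)
  refine hasSum_of_forall_eq (fun s => ?_) h4
  simp [Equiv.sigmaFiberEquiv, Finset.prod_mul_distrib, s.2]

/-- A multiple zeta value with constant argument as a sum over finite sets of naturals; sets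
containing `0` contribute nothing. -/
theorem mzv_twelve_eq_tsum (n : ℕ) :
    mzv (fun _ : Fin n => (12 : ℝ)) =
      ∑' s : {s : Finset ℕ // s.card = n}, ∏ k ∈ s.1, ((k : ℝ) ^ 12)⁻¹ := by
  unfold mzv
  let g : {f : Fin n → ℕ // (∀ i, 1 ≤ f i) ∧ StrictMono f} → {s : Finset ℕ // s.card = n} :=
    fun f => ⟨Finset.univ.image f.1, by
      rw [Finset.card_image_of_injective _ f.2.2.injective, Finset.card_univ, Fintype.card_fin]⟩
  have hg : Function.Injective g := by
    intro f₁ f₂ h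
    have h' : Finset.univ.image f₁.1 = Finset.univ.image f₂.1 := congrArg Subtype.val h
    have h'' := congrArg (fun s : Finset ℕ => (s : Set ℕ)) h'
    simp only [Finset.coe_image, Finset.coe_univ, Set.image_univ] at h''
    exact Subtype.ext ((StrictMono.range_inj f₁.2.2 f₂.2.2).mp h'')
  rw [← hg.tsum_eq]
  · refine tsum_congr fun f => ?_
    simp only [g]
    rw [Finset.prod_image fun a _ b _ h => f.2.2.injective h]
    refine Finset.prod_congr rfl fun i _ => ?_
    rw [Real.rpow_neg (Nat.cast_nonneg _)]
    norm_cast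
  · intro s hs
    have h0 : ∀ k ∈ s.1, 1 ≤ k := by
      intro k hk
      by_contra hlt
      have hk0 : k = 0 := by omega
      exact hs (Finset.prod_eq_zero hk (by simp [hk0]))
    refine ⟨⟨s.1.orderEmbOfFin s.2, fun i => h0 _ (Finset.orderEmbOfFin_mem _ _ _),
      (s.1.orderEmbOfFin s.2).strictMono⟩, ?_⟩
    exact Subtype.ext (Finset.image_orderEmbOfFin_univ s.1 s.2)

open Filter Topology in
/-- The generating function of `ζ({12}^n)` as a limit of finite products. -/
theorem exists_hasSum_mzv_twelve (w : ℂ) :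
    ∃ P : ℂ, HasSum (fun n : ℕ => w ^ n * (mzv (fun _ : Fin n => (12 : ℝ)) : ℂ)) P ∧
      Tendsto (fun N => ∏ j ∈ Finset.range N, (1 + w / ((j : ℂ) + 1) ^ 12)) atTop (𝓝 P) := by
  have hf : Summable fun k : ℕ => ‖(((k : ℝ) ^ 12)⁻¹ : ℝ)‖ :=
    (Real.summable_nat_pow_inv.mpr (by norm_num)).norm
  have hf' : Summable fun k : ℕ => ‖((((k : ℝ) ^ 12)⁻¹ : ℝ) : ℂ)‖ := by
    simpa only [Complex.norm_real] using hf
  refine ⟨∏' k : ℕ, (1 + w * ((((k : ℝ) ^ 12)⁻¹ : ℝ) : ℂ)), ?_, ?_⟩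
  · convert hasSum_pow_mul_tsum_prod hf' w using 3 with n
    rw [mzv_twelve_eq_tsum, Complex.ofReal_tsum]
    simp only [Complex.ofReal_prod]
  · have hm : Multipliable fun k : ℕ => 1 + w * ((((k : ℝ) ^ 12)⁻¹ : ℝ) : ℂ) :=
      multipliable_one_add_of_summable (by simpa only [norm_mul] using hf'.mul_left ‖w‖)
    have ht := hm.hasProd.tendsto_prod_nat.comp (tendsto_add_atTop_nat 1)
    refine ht.congr fun N => ?_
    simp only [Function.comp_apply, Finset.prod_range_succ']
    simp [div_eq_mul_inv]

theorem four_mul_sin_mul_sin_mul_sin_add (a b : ℂ) :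
    4 * (Complex.sin a * Complex.sin b * Complex.sin (a + b)) =
      Complex.sin (2 * a) + Complex.sin (2 * b) - Complex.sin (2 * (a + b)) := by
  have ha := Complex.sin_sq_add_cos_sq a
  have hb := Complex.sin_sq_add_cos_sq b
  simp only [Complex.sin_two_mul, Complex.sin_add, Complex.cos_add]
  grind

open Filter Topology in
/-- The product of the sines of the sixth-order rotations of `π z`, where `s` is a square root
of `3`. -/
theorem prod_sin_rotations {s : ℂ} (hs : s ^ 2 = 3) (z : ℂ) {P : ℂ}
    (hP : Tendsto (fun N => ∏ j ∈ Finset.range N, (1 + -(z ^ 12) / ((j : ℂ) + 1) ^ 12))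
      atTop (𝓝 P)) :
    (Complex.sin (π * z) * Complex.sin (π * ((-1 + s * Complex.I) / 2 * z)) *
        Complex.sin (π * ((1 + s * Complex.I) / 2 * z))) *
      (Complex.sin (π * ((s + Complex.I) / 2 * z)) *
        Complex.sin (π * ((-s + Complex.I) / 2 * z)) * Complex.sin (π * (Complex.I * z))) =
      Complex.I * π ^ 6 * z ^ 6 * P := by
  have hI : Complex.I ^ 2 = -1 := Complex.I_sq
  have h := (((Complex.tendsto_euler_sin_prod z).mul
      (Complex.tendsto_euler_sin_prod ((-1 + s * Complex.I) / 2 * z))).mul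
      (Complex.tendsto_euler_sin_prod ((1 + s * Complex.I) / 2 * z))).mul
    (((Complex.tendsto_euler_sin_prod ((s + Complex.I) / 2 * z)).mul
      (Complex.tendsto_euler_sin_prod ((-s + Complex.I) / 2 * z))).mul
      (Complex.tendsto_euler_sin_prod (Complex.I * z)))
  refine tendsto_nhds_unique h ((hP.const_mul (Complex.I * π ^ 6 * z ^ 6)).congr fun N => ?_)
  have hfac : ∀ x : ℂ, 1 + -(z ^ 12) / x ^ 12 =
      (1 - z ^ 2 / x ^ 2) * (1 - ((-1 + s * Complex.I) / 2 * z) ^ 2 / x ^ 2) *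
        (1 - ((1 + s * Complex.I) / 2 * z) ^ 2 / x ^ 2) *
      ((1 - ((s + Complex.I) / 2 * z) ^ 2 / x ^ 2) *
        (1 - ((-s + Complex.I) / 2 * z) ^ 2 / x ^ 2) *
        (1 - (Complex.I * z) ^ 2 / x ^ 2)) := by
    intro x
    have hx : -(z ^ 12) / x ^ 12 = -((z ^ 2 / x ^ 2) ^ 6) := by
      rw [div_pow]; ring
    have hc : ∀ c : ℂ, (c * z) ^ 2 / x ^ 2 = c ^ 2 * (z ^ 2 / x ^ 2) := by
      intro c; ring
    rw [hx, hc, hc, hc, hc, hc]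
    generalize z ^ 2 / x ^ 2 = y
    generalize Complex.I = i at *
    have e1 : ((-1 + s * i) / 2) ^ 2 = -(1 + s * i) / 2 := by grind
    have e2 : ((1 + s * i) / 2) ^ 2 = (-1 + s * i) / 2 := by grind
    have e3 : ((s + i) / 2) ^ 2 = (1 + s * i) / 2 := by grind
    have e4 : ((-s + i) / 2) ^ 2 = (1 - s * i) / 2 := by grind
    rw [e1, e2, e3, e4, hI]
    have hsi : (s * i) ^ 2 = -3 := by rw [mul_pow, hs, hI]; norm_num
    generalize s * i = t at *
    grind
  rw [Finset.prod_congr rfl fun (j : ℕ) _ => hfac ((j : ℂ) + 1)]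
  simp only [Finset.prod_mul_distrib]
  generalize Complex.I = i at *
  have hcoef : ((-1 + s * i) / 2) * ((1 + s * i) / 2) *
      (((s + i) / 2) * ((-s + i) / 2) * i) = i := by grind
  nth_rewrite 1 [← hcoef]
  ring

/-- The product of the six sines as a combination of eighteen cosines. -/
theorem prod_sin_rotations_eq_sum_cos (s θ : ℂ) {A B : Fin 3 → ℂ}
    (hA : A = ![1, (-1 + s * Complex.I) / 2, -(1 + s * Complex.I) / 2])
    (hB : B = ![(s + Complex.I) / 2, (-s + Complex.I) / 2, -Complex.I]) :
    32 * ((Complex.sin θ * Complex.sin ((-1 + s * Complex.I) / 2 * θ) *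
        Complex.sin ((1 + s * Complex.I) / 2 * θ)) *
      (Complex.sin ((s + Complex.I) / 2 * θ) *
        Complex.sin ((-s + Complex.I) / 2 * θ) * Complex.sin (Complex.I * θ))) =
      ∑ p, ∑ q, (Complex.cos (2 * θ * (A p - B q)) - Complex.cos (2 * θ * (A p + B q))) := by
  have h1 := four_mul_sin_mul_sin_mul_sin_add θ ((-1 + s * Complex.I) / 2 * θ)
  have h2 := four_mul_sin_mul_sin_mul_sin_add ((s + Complex.I) / 2 * θ)
    ((-s + Complex.I) / 2 * θ)
  rw [show θ + (-1 + s * Complex.I) / 2 * θ = (1 + s * Complex.I) / 2 * θ by ring] at h1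
  rw [show (s + Complex.I) / 2 * θ + (-s + Complex.I) / 2 * θ = Complex.I * θ by ring] at h2
  have hA' : ∑ p, Complex.sin (2 * θ * A p) = Complex.sin (2 * θ) +
      Complex.sin (2 * ((-1 + s * Complex.I) / 2 * θ)) -
      Complex.sin (2 * ((1 + s * Complex.I) / 2 * θ)) := by
    rw [Fin.sum_univ_three, sub_eq_add_neg, ← Complex.sin_neg]
    simp only [hA, Matrix.cons_val]
    congr 2 <;> ring_nf
  have hB' : ∑ q, Complex.sin (2 * θ * B q) = Complex.sin (2 * ((s + Complex.I) / 2 * θ)) +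
      Complex.sin (2 * ((-s + Complex.I) / 2 * θ)) - Complex.sin (2 * (Complex.I * θ)) := by
    rw [Fin.sum_univ_three, sub_eq_add_neg, ← Complex.sin_neg]
    simp only [hB, Matrix.cons_val]
    congr 2 <;> ring_nf
  have hcos : ∀ p q, Complex.cos (2 * θ * (A p - B q)) - Complex.cos (2 * θ * (A p + B q)) =
      2 * (Complex.sin (2 * θ * A p) * Complex.sin (2 * θ * B q)) := by
    intro p q
    rw [mul_sub, mul_add, Complex.cos_sub, Complex.cos_add]
    ring
  simp only [hcos, ← Finset.mul_sum]
  rw [← Finset.sum_mul, hA', hB', ← h1, ← h2]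
  ring

/-- The power sums occurring in the coefficients of `z ^ (12 * n + 6)`. -/
theorem sum_pow_rotations {s : ℂ} (hs : s ^ 2 = 3) (n : ℕ) {A B : Fin 3 → ℂ}
    (hA : A = ![1, (-1 + s * Complex.I) / 2, -(1 + s * Complex.I) / 2])
    (hB : B = ![(s + Complex.I) / 2, (-s + Complex.I) / 2, -Complex.I]) :
    2 ^ (6 * n + 3) *
        ∑ p, ∑ q, ((A p - B q) ^ (12 * n + 6) - (A p + B q) ^ (12 * n + 6)) =
      -6 * Complex.I * (-1) ^ n *
        (2 ^ (12 * n + 6) + (s + 1) ^ (12 * n + 6) + (s - 1) ^ (12 * n + 6)) := by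
  have hI : Complex.I ^ 2 = -1 := Complex.I_sq
  have hexp : ∀ x : ℂ, x ^ (12 * n + 6) = (x ^ 6) ^ (2 * n + 1) := by
    intro x; rw [← pow_mul]; congr 1; ring
  have h2 : (2 : ℂ) ^ (6 * n + 3) = 8 ^ (2 * n + 1) := by
    rw [show 6 * n + 3 = 3 * (2 * n + 1) by ring, pow_mul]; norm_num
  have hi : Complex.I ^ (2 * n + 1) = Complex.I * (-1) ^ n := by
    rw [pow_succ, pow_mul, hI]; ring
  have hs1 : (s + 1) ^ 6 = 8 * (26 + 15 * s) := by grind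
  have hs2 : (s - 1) ^ 6 = 8 * (26 - 15 * s) := by grind
  have h64 : (2 : ℂ) ^ 6 = 8 * 8 := by norm_num
  have hodd : Odd (2 * n + 1) := ⟨n, rfl⟩
  simp only [Fin.sum_univ_three, hexp, hs1, hs2, h64, h2, hA, hB, Matrix.cons_val]
  have key : ∀ u C : ℂ, u ^ 6 = C * Complex.I →
      (u ^ 6) ^ (2 * n + 1) = C ^ (2 * n + 1) * (Complex.I * (-1) ^ n) := by
    intro u C h; rw [h, mul_pow, hi]
  rw [key (1 - (s + Complex.I) / 2) (-(26 - 15 * s)) (by grind),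
    key (1 + (s + Complex.I) / 2) ((26 + 15 * s)) (by grind),
    key (1 - (-s + Complex.I) / 2) (-(26 + 15 * s)) (by grind),
    key (1 + (-s + Complex.I) / 2) ((26 - 15 * s)) (by grind),
    key (1 - -Complex.I) (-8) (by grind),
    key (1 + -Complex.I) (8) (by grind),
    key ((-1 + s * Complex.I) / 2 - (s + Complex.I) / 2) (-8) (by grind),
    key ((-1 + s * Complex.I) / 2 + (s + Complex.I) / 2) (8) (by grind),
    key ((-1 + s * Complex.I) / 2 - (-s + Complex.I) / 2) (-(26 - 15 * s)) (by grind),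
    key ((-1 + s * Complex.I) / 2 + (-s + Complex.I) / 2) ((26 + 15 * s)) (by grind),
    key ((-1 + s * Complex.I) / 2 - -Complex.I) (-(26 + 15 * s)) (by grind),
    key ((-1 + s * Complex.I) / 2 + -Complex.I) ((26 - 15 * s)) (by grind),
    key (-(1 + s * Complex.I) / 2 - (s + Complex.I) / 2) (-(26 + 15 * s)) (by grind),
    key (-(1 + s * Complex.I) / 2 + (s + Complex.I) / 2) ((26 - 15 * s)) (by grind),
    key (-(1 + s * Complex.I) / 2 - (-s + Complex.I) / 2) (-8) (by grind),
    key (-(1 + s * Complex.I) / 2 + (-s + Complex.I) / 2) (8) (by grind),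
    key (-(1 + s * Complex.I) / 2 - -Complex.I) (-(26 - 15 * s)) (by grind),
    key (-(1 + s * Complex.I) / 2 + -Complex.I) ((26 + 15 * s)) (by grind)]
  simp only [hodd.neg_pow, mul_pow]
  ring

theorem hasSum_cos_mul (u z : ℂ) :
    HasSum (fun k : ℕ => (z ^ 2) ^ k *
      ((-1) ^ k * (2 * π) ^ (2 * k) / ((2 * k).factorial : ℂ) * u ^ (2 * k)))
      (Complex.cos (2 * (π * z) * u)) := by
  refine hasSum_of_forall_eq (fun k => ?_) (Complex.hasSum_cos (2 * (π * z) * u))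
  rw [show 2 * (π * z) * u = 2 * π * u * z by ring, mul_pow _ z, mul_pow _ u, pow_mul z]
  ring

/-- Comparison of the coefficients of `z ^ (12 * n + 6)` in the product of the six sines. -/
theorem mzv_twelve_coeff {s : ℂ} (hs : s ^ 2 = 3) (n : ℕ) {A B : Fin 3 → ℂ}
    (hA : A = ![1, (-1 + s * Complex.I) / 2, -(1 + s * Complex.I) / 2])
    (hB : B = ![(s + Complex.I) / 2, (-s + Complex.I) / 2, -Complex.I]) :
    32 * Complex.I * π ^ 6 * ((-1) ^ n * (mzv (fun _ : Fin n => (12 : ℝ)) : ℂ)) =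
      -((2 * π) ^ (12 * n + 6) / ((12 * n + 6).factorial : ℂ) *
        ∑ p, ∑ q, ((A p - B q) ^ (12 * n + 6) - (A p + B q) ^ (12 * n + 6))) := by
  obtain ⟨Z, hZ⟩ : ∃ Z : ℕ → ℂ, ∀ m, (mzv (fun _ : Fin m => (12 : ℝ)) : ℂ) = Z m :=
    ⟨_, fun _ => rfl⟩
  rw [hZ]
  let b : ℕ → ℂ := fun k => (-1) ^ k * (2 * π) ^ (2 * k) / ((2 * k).factorial : ℂ) *
    ∑ p, ∑ q, ((A p - B q) ^ (2 * k) - (A p + B q) ^ (2 * k))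
  let a : ℕ → ℂ := fun k => if k % 6 = 3 then
    32 * Complex.I * π ^ 6 * ((-1) ^ (k / 6) * Z (k / 6)) else 0
  have hb : ∀ z : ℂ, HasSum (fun k : ℕ => (z ^ 2) ^ k * b k)
      (∑ p, ∑ q, (Complex.cos (2 * (π * z) * (A p - B q)) -
        Complex.cos (2 * (π * z) * (A p + B q)))) := by
    intro z
    have h := hasSum_sum (s := Finset.univ) fun (p : Fin 3) _ =>
      hasSum_sum (s := Finset.univ) fun (q : Fin 3) _ =>
        (hasSum_cos_mul (A p - B q) z).sub (hasSum_cos_mul (A p + B q) z)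
    refine hasSum_of_forall_eq (fun k => ?_) h
    simp only [b, Finset.mul_sum, mul_sub]
  have ha : ∀ z : ℂ, HasSum (fun k : ℕ => (z ^ 2) ^ k * a k)
      (∑ p, ∑ q, (Complex.cos (2 * (π * z) * (A p - B q)) -
        Complex.cos (2 * (π * z) * (A p + B q)))) := by
    intro z
    obtain ⟨P, hP, hlim⟩ := exists_hasSum_mzv_twelve (-(z ^ 12))
    simp only [hZ] at hP
    have hprod := prod_sin_rotations hs z hlim
    have hcos := prod_sin_rotations_eq_sum_cos s (π * z) hA hB
    simp only [mul_left_comm (π : ℂ) _ z] at hprod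
    rw [← hcos, hprod]
    have hg : Function.Injective fun m : ℕ => 6 * m + 3 := by
      intro x y h
      simp only at h
      omega
    refine (hg.hasSum_iff ?_).mp ?_
    · intro k hk
      have : k % 6 ≠ 3 := fun h => hk ⟨k / 6, by simp only; omega⟩
      simp [a, this]
    · have hval : 32 * (Complex.I * π ^ 6 * z ^ 6 * P) =
          32 * (Complex.I * π ^ 6 * z ^ 6) * P := by ring
      rw [hval]
      refine hasSum_of_forall_eq (fun m => ?_) (hP.mul_left (32 * (Complex.I * π ^ 6 * z ^ 6)))
      have h1 : (6 * m + 3) % 6 = 3 := by omega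
      have h2 : (6 * m + 3) / 6 = m := by omega
      simp only [Function.comp_apply, a, h1, h2, if_true]
      rw [neg_pow (z ^ 12) m]
      ring
  have hsqrt : ∀ w : ℂ, ∃ z, z ^ 2 = w := fun w => IsAlgClosed.exists_pow_nat_eq w two_pos
  have hab : a = b := by
    refine eq_of_forall_hasSum_pow_mul (f := fun w => ∑' k, w ^ k * b k) ?_ ?_
    · intro w
      obtain ⟨z, rfl⟩ := hsqrt w
      simpa only [(hb z).tsum_eq] using ha z
    · intro w
      obtain ⟨z, rfl⟩ := hsqrt w
      exact (hb z).summable.hasSum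
  have h := congrFun hab (6 * n + 3)
  have h1 : (6 * n + 3) % 6 = 3 := by omega
  have h2 : (6 * n + 3) / 6 = n := by omega
  have h3 : 2 * (6 * n + 3) = 12 * n + 6 := by ring
  have h4 : (-1 : ℂ) ^ (6 * n + 3) = -1 := Odd.neg_one_pow ⟨3 * n + 1, by ring⟩
  simp only [a, b, h1, h2, h3, h4, if_true] at h
  rw [h]
  ring

/-- `ζ({12}^n) = (3·2^{6n-1} π^{12n}/(12n+6)!) (2^{12n+6} + (√3+1)^{12n+6} + (√3-1)^{12n+6})`. -/
theorem zeta_twelve_rep (n : ℕ) (hn : 1 ≤ n) :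
    mzv (fun _ : Fin n => (12 : ℝ)) =
      3 * 2 ^ (6 * n - 1) * π ^ (12 * n) / (Nat.factorial (12 * n + 6)) *
        ((2 : ℝ) ^ (12 * n + 6) + (Real.sqrt 3 + 1) ^ (12 * n + 6)
          + (Real.sqrt 3 - 1) ^ (12 * n + 6)) := by
  have hs : ((Real.sqrt 3 : ℝ) : ℂ) ^ 2 = 3 := by
    rw [← Complex.ofReal_pow, Real.sq_sqrt (by norm_num)]
    norm_num
  have hcoeff := mzv_twelve_coeff hs n rfl rfl
  have hsum := sum_pow_rotations hs n rfl rfl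
  obtain ⟨m, rfl⟩ : ∃ m, n = m + 1 := ⟨n - 1, by omega⟩
  have hfact : ((12 * (m + 1) + 6).factorial : ℂ) ≠ 0 := by
    exact_mod_cast Nat.factorial_ne_zero _
  have hπ : (π : ℂ) ≠ 0 := by exact_mod_cast Real.pi_ne_zero
  have hI : Complex.I * π ^ 6 * (-1) ^ (m + 1) * 2 ^ (6 * (m + 1) + 3) * 32 ≠ 0 := by
    simp [hπ]
  apply Complex.ofReal_injective
  push_cast
  refine mul_left_cancel₀ hI ?_
  set M : ℂ := ((mzv fun _ : Fin (m + 1) => (12 : ℝ) : ℝ) : ℂ)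
  set F : ℂ := ((12 * (m + 1) + 6).factorial : ℂ)
  rw [show 6 * (m + 1) - 1 = 6 * m + 5 by omega]
  calc _ = 2 ^ (6 * (m + 1) + 3) * (32 * Complex.I * π ^ 6 * ((-1) ^ (m + 1) * M)) := by ring
    _ = -((2 * π) ^ (12 * (m + 1) + 6) / F) * (-6 * Complex.I * (-1) ^ (m + 1) *
        (2 ^ (12 * (m + 1) + 6) + ((Real.sqrt 3 : ℝ) + 1 : ℂ) ^ (12 * (m + 1) + 6) +
          ((Real.sqrt 3 : ℝ) - 1 : ℂ) ^ (12 * (m + 1) + 6))) := by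
      rw [hcoeff, ← hsum]
      ring
    _ = _ := by
      generalize (2 ^ (12 * (m + 1) + 6) + ((Real.sqrt 3 : ℝ) + 1 : ℂ) ^ (12 * (m + 1) + 6) +
          ((Real.sqrt 3 : ℝ) - 1 : ℂ) ^ (12 * (m + 1) + 6)) = S
      rw [mul_pow]
      ring
end

section
/- Let m be an even positive integer and n a positive integer. Then ζ⋆({2m}^n) = (2π)^{2mn} · Σ_{p₁+p₂+⋯+p_m = mn, pⱼ≥0} ( Π_{j=1}^{m} B_{2pⱼ}(1/2) / (2pⱼ)! ) · exp( (2πi/m) · Σ_{ℓ=1}^{m} (ℓ−1) p_ℓ ), where B_j(x) denotes the j-th Bernoulli polynomial. -/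
open Real Finset

/-- The monotone functions `Fin n → ℕ` with values in `{1, …, N}`. -/
noncomputable def monotoneTuples (n N : ℕ) : Finset (Fin n → ℕ) :=
  open scoped Classical in {f ∈ Fintype.piFinset (fun _ => Icc 1 N) | Monotone f}

lemma mem_monotoneTuples {n N : ℕ} {f : Fin n → ℕ} :
    f ∈ monotoneTuples n N ↔ (∀ i, 1 ≤ f i ∧ f i ≤ N) ∧ Monotone f := by
  simp [monotoneTuples]

lemma sum_monotoneTuples_succ {R : Type*} [CommSemiring R] (x : ℕ → R) (n N : ℕ) :
    ∑ f ∈ monotoneTuples (n + 1) (N + 1), ∏ i, x (f i) =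
      ∑ f ∈ monotoneTuples (n + 1) N, ∏ i, x (f i) +
        x (N + 1) * ∑ f ∈ monotoneTuples n (N + 1), ∏ i, x (f i) := by
  rw [← sum_filter_not_add_sum_filter _ (fun f => f (Fin.last n) = N + 1)]
  congr 1
  · refine sum_congr ?_ fun _ _ => rfl
    ext f
    simp only [mem_filter, mem_monotoneTuples]
    constructor
    · rintro ⟨⟨h, hf⟩, hl⟩
      refine ⟨fun i => ⟨(h i).1, ?_⟩, hf⟩
      have := hf (Fin.le_last i)
      have := (h (Fin.last n)).2
      omega
    · rintro ⟨h, hf⟩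
      refine ⟨⟨fun i => ⟨(h i).1, (h i).2.trans N.le_succ⟩, hf⟩, ?_⟩
      have := (h (Fin.last n)).2
      omega
  · rw [mul_sum]
    refine sum_bij' (fun f _ => Fin.init f) (fun g _ => Fin.snoc g (N + 1)) ?_ ?_ ?_ ?_ ?_
    · intro f hf
      simp only [mem_filter, mem_monotoneTuples] at hf ⊢
      exact ⟨fun i => hf.1.1 _, fun i j hij => hf.1.2 (by simpa using hij)⟩
    · intro g hg
      simp only [mem_filter, mem_monotoneTuples] at hg ⊢
      refine ⟨⟨fun i => ?_, fun i j hij => ?_⟩, by simp⟩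
      · refine Fin.lastCases (by simp) (fun i => ?_) i
        simpa using hg.1 i
      · induction j using Fin.lastCases with
        | last =>
          induction i using Fin.lastCases with
          | last => rfl
          | cast i => simpa using (hg.1 i).2
        | cast j =>
          induction i using Fin.lastCases with
          | last => exact absurd hij (by simp)
          | cast i => simpa using hg.2 (by simpa using hij)
    · intro f hf
      simp only [mem_filter] at hf
      rw [← hf.2, Fin.snoc_init_self]
    · intro g _
      simp
    · intro f hf
      simp only [mem_filter] at hf
      rw [Fin.prod_univ_castSucc, hf.2, mul_comm]
      rfl

namespace PowerSeries

section CommRing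

variable {R : Type*} [CommRing R]

lemma mk_pow_mul_one_sub (a : R) : mk (fun i => a ^ i) * (1 - C a * X) = 1 := by
  ext n
  cases n with
  | zero => simp [mul_sub]
  | succ n =>
    rw [mul_sub, mul_one, ← mul_assoc, map_sub, coeff_succ_mul_X, coeff_mul_C]
    simp [coeff_one, pow_succ]

/-- The generating series `∏_{k ≤ N} (1 - x_k X)⁻¹` of the complete homogeneous symmetric
polynomials in `x 1, …, x N`. -/
noncomputable def completeSeries (x : ℕ → R) (N : ℕ) : R⟦X⟧ :=
  ∏ k ∈ Icc 1 N, mk fun i => x k ^ i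

lemma completeSeries_succ (x : ℕ → R) (N : ℕ) :
    completeSeries x (N + 1) = completeSeries x N * mk fun i => x (N + 1) ^ i := by
  rw [completeSeries, prod_Icc_succ_top (by omega), completeSeries]

lemma coeff_completeSeries (x : ℕ → R) (n N : ℕ) :
    coeff n (completeSeries x N) = ∑ f ∈ monotoneTuples n N, ∏ i, x (f i) := by
  induction N generalizing n with
  | zero =>
    cases n with
    | zero =>
      have : monotoneTuples 0 0 = {Fin.elim0} := by
        ext f
        simp [mem_monotoneTuples, Subsingleton.elim f Fin.elim0, Subsingleton.monotone]
      simp [completeSeries, this]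
    | succ n =>
      have : monotoneTuples (n + 1) 0 = ∅ := by
        ext f
        simp only [mem_monotoneTuples, notMem_empty, iff_false]
        rintro ⟨h, -⟩
        have := h 0
        omega
      simp [completeSeries, this, coeff_one]
  | succ N ih =>
    induction n with
    | zero =>
      have : monotoneTuples 0 (N + 1) = {Fin.elim0} := by
        ext f
        simp [mem_monotoneTuples, Subsingleton.elim f Fin.elim0, Subsingleton.monotone]
      simp [completeSeries, this, map_prod]
    | succ n ihn =>
      rw [sum_monotoneTuples_succ, ← ih, ← ihn]
      have h : completeSeries x (N + 1) * (1 - C (x (N + 1)) * X) = completeSeries x N := by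
        rw [completeSeries_succ, mul_assoc, mk_pow_mul_one_sub, mul_one]
      rw [← h, mul_sub, mul_one, ← mul_assoc, map_sub, coeff_succ_mul_X, coeff_mul_C]
      ring

lemma derivative_mk_pow (a : R) :
    d⁄dX R (mk fun i => a ^ i) = mk (fun i => a ^ i) * mk fun i => a ^ (i + 1) := by
  have h := mk_pow_mul_one_sub a
  have hd := congrArg (d⁄dX R) h
  have h2 : (mk fun i => a ^ (i + 1)) = C a * mk fun i => a ^ i := by
    ext n
    simp [pow_succ']
  simp only [Derivation.leibniz, smul_eq_mul, map_sub, derivative_one, derivative_C,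
    derivative_X] at hd
  rw [h2]
  linear_combination (mk fun i => a ^ i) * hd - d⁄dX R (mk fun i => a ^ i) * h

lemma derivative_completeSeries (x : ℕ → R) (N : ℕ) :
    d⁄dX R (completeSeries x N) =
      completeSeries x N * mk fun i => ∑ k ∈ Icc 1 N, x k ^ (i + 1) := by
  induction N with
  | zero =>
    ext
    simp [completeSeries]
  | succ N ih =>
    have : (mk fun i => ∑ k ∈ Icc 1 (N + 1), x k ^ (i + 1)) =
        (mk fun i => ∑ k ∈ Icc 1 N, x k ^ (i + 1)) + mk fun i => x (N + 1) ^ (i + 1) := by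
      ext n
      simp [sum_Icc_succ_top]
    rw [completeSeries_succ, Derivation.leibniz, ih, derivative_mk_pow, this]
    simp only [smul_eq_mul]
    ring

/-- Newton's identity between complete homogeneous symmetric polynomials and power sums. -/
lemma succ_mul_coeff_completeSeries (x : ℕ → R) (n N : ℕ) :
    (n + 1) * coeff (n + 1) (completeSeries x N) =
      ∑ p ∈ antidiagonal n,
        coeff p.1 (completeSeries x N) * ∑ k ∈ Icc 1 N, x k ^ (p.2 + 1) := by
  have h := congrArg (coeff n) (derivative_completeSeries x N)
  rw [coeff_derivative, coeff_mul] at h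
  simpa [mul_comm] using h

end CommRing

section Domain

variable {R : Type*} [CommRing R] [IsDomain R] {ζ : R} {m : ℕ}

lemma _root_.IsPrimitiveRoot.pow_sub_pow_eq_prod_fin (hζ : IsPrimitiveRoot ζ m) (hm : 0 < m)
    (x y : R) : x ^ m - y ^ m = ∏ j : Fin m, (x - ζ ^ (j : ℕ) * y) := by
  rw [hζ.pow_sub_pow_eq_prod_sub_mul x y hm]
  symm
  refine prod_bij (fun j _ => ζ ^ (j : ℕ)) ?_ ?_ ?_ fun _ _ => rfl
  · intro j _
    rw [Polynomial.mem_nthRootsFinset hm, ← pow_mul, mul_comm, pow_mul, hζ.pow_eq_one, one_pow]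
  · intro i _ j _ h
    exact Fin.ext (hζ.pow_inj i.2 j.2 h)
  · intro b hb
    rw [Polynomial.mem_nthRootsFinset hm] at hb
    have : NeZero m := ⟨hm.ne'⟩
    obtain ⟨i, hi, rfl⟩ := hζ.eq_pow_of_pow_eq_one hb
    exact ⟨⟨i, hi⟩, mem_univ _, rfl⟩

lemma prod_rescale_mk_pow (hζ : IsPrimitiveRoot ζ m) (hm : 0 < m) (a : R) :
    ∏ j : Fin m, rescale (ζ ^ (j : ℕ)) (mk fun i => a ^ i) =
      expand m hm.ne' (mk fun i => (a ^ m) ^ i) := by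
  have h1 : (∏ j : Fin m, rescale (ζ ^ (j : ℕ)) (mk fun i => a ^ i)) *
      (1 - C (a ^ m) * X ^ m) = 1 := by
    have hC : IsPrimitiveRoot (C ζ : R⟦X⟧) m := hζ.map_of_injective C_injective
    have := hC.pow_sub_pow_eq_prod_fin hm 1 (C a * X)
    rw [one_pow, mul_pow, ← map_pow] at this
    rw [this, ← prod_mul_distrib]
    refine prod_eq_one fun j _ => ?_
    have hr : rescale (ζ ^ (j : ℕ)) (mk fun i => a ^ i) =
        mk fun i => (ζ ^ (j : ℕ) * a) ^ i := by
      ext n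
      simp [coeff_rescale, mul_pow]
    simpa [hr, mul_assoc] using mk_pow_mul_one_sub (ζ ^ (j : ℕ) * a)
  have h2 : expand m hm.ne' (mk fun i => (a ^ m) ^ i) * (1 - C (a ^ m) * X ^ m) = 1 := by
    have := congrArg (expand m hm.ne') (mk_pow_mul_one_sub (a ^ m))
    simpa only [map_mul, map_sub, map_one, expand_C, expand_X] using this
  exact left_inv_eq_right_inv h1 (by rw [mul_comm]; exact h2)

lemma prod_rescale_completeSeries (hζ : IsPrimitiveRoot ζ m) (hm : 0 < m) (x : ℕ → R) (N : ℕ) :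
    ∏ j : Fin m, rescale (ζ ^ (j : ℕ)) (completeSeries x N) =
      expand m hm.ne' (completeSeries (fun k => x k ^ m) N) := by
  simp only [completeSeries, map_prod]
  rw [prod_comm]
  exact prod_congr rfl fun k _ => prod_rescale_mk_pow hζ hm (x k)

lemma coeff_prod_fin {R : Type*} [CommSemiring R] {m : ℕ} (f : Fin m → R⟦X⟧) (d : ℕ) :
    coeff d (∏ j, f j) = ∑ p ∈ Finset.Nat.antidiagonalTuple m d, ∏ j, coeff (p j) (f j) := by
  rw [coeff_prod, ← piAntidiag_univ_fin_eq_antidiagonalTuple]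
  refine sum_bij (fun l _ => ⇑l) ?_ (fun _ _ _ _ h => DFunLike.coe_injective h) ?_ fun _ _ => rfl
  · intro l hl
    simpa using hl
  · intro p hp
    exact ⟨Finsupp.equivFunOnFinite.symm p, by simpa using hp, by simp⟩

lemma coeff_completeSeries_pow (hζ : IsPrimitiveRoot ζ m) (hm : 0 < m) (x : ℕ → R) (n N : ℕ) :
    coeff n (completeSeries (fun k => x k ^ m) N) =
      ∑ p ∈ Finset.Nat.antidiagonalTuple m (m * n),
        (∏ j, coeff (p j) (completeSeries x N)) * ζ ^ (∑ j : Fin m, (j : ℕ) * p j) := by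
  rw [← coeff_expand_mul m hm.ne', ← prod_rescale_completeSeries hζ hm, coeff_prod_fin]
  refine sum_congr rfl fun p _ => ?_
  simp only [coeff_rescale, prod_mul_distrib, ← pow_mul, prod_pow_eq_pow_sum]
  rw [mul_comm]

end Domain

end PowerSeries

open Filter Topology

lemma hasSum_monotone_of_tendsto {n : ℕ} {x : ℕ → ℝ} (hx : ∀ k, 0 ≤ x k) {L : ℝ}
    (h : Tendsto (fun N => ∑ f ∈ monotoneTuples n N, ∏ i, x (f i)) atTop (𝓝 L)) :
    HasSum (fun f : {f : Fin n → ℕ // (∀ i, 1 ≤ f i) ∧ Monotone f} => ∏ i, x (f.1 i)) L := by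
  classical
  have hmono : Monotone fun N => ∑ f ∈ monotoneTuples n N, ∏ i, x (f i) := by
    intro M N hMN
    refine sum_le_sum_of_subset_of_nonneg (fun f hf => ?_) fun f _ _ =>
      prod_nonneg fun i _ => hx _
    rw [mem_monotoneTuples] at hf ⊢
    exact ⟨fun i => ⟨(hf.1 i).1, (hf.1 i).2.trans hMN⟩, hf.2⟩
  have hlub := isLUB_of_tendsto_atTop hmono h
  refine hasSum_of_isLUB_of_nonneg L (fun f => prod_nonneg fun i _ => hx _) ⟨?_, ?_⟩
  · rintro _ ⟨s, rfl⟩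
    let N := s.sup fun f => univ.sup f.1
    refine le_trans ?_ (hlub.1 ⟨N, rfl⟩)
    dsimp only
    refine (sum_map s (Function.Embedding.subtype _)
      fun f : Fin n → ℕ => ∏ i, x (f i)).symm.trans_le ?_
    refine sum_le_sum_of_subset_of_nonneg (fun f hf => ?_) fun f _ _ =>
      prod_nonneg fun i _ => hx _
    simp only [Finset.mem_map, Function.Embedding.subtype_apply] at hf
    obtain ⟨g, hg, rfl⟩ := hf
    rw [mem_monotoneTuples]
    refine ⟨fun i => ⟨g.2.1 i, ?_⟩, g.2.2⟩
    exact (le_sup (f := g.1) (mem_univ i)).trans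
      (le_sup (f := fun f : {f : Fin n → ℕ // (∀ i, 1 ≤ f i) ∧ Monotone f} => univ.sup f.1) hg)
  · intro b hb
    refine hlub.2 ?_
    rintro _ ⟨N, rfl⟩
    refine le_trans (le_of_eq ?_)
      (hb ⟨(monotoneTuples n N).subtype fun f => (∀ i, 1 ≤ f i) ∧ Monotone f, rfl⟩)
    dsimp only
    rw [sum_subtype_of_mem (fun f : Fin n → ℕ => ∏ i, x (f i))]
    intro f hf
    rw [mem_monotoneTuples] at hf
    exact ⟨fun i => (hf.1 i).1, hf.2⟩

/-- The coefficients of `t e^{t/2} / (e^t - 1)`. -/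
noncomputable def halfBernoulli (n : ℕ) : ℚ :=
  (Polynomial.bernoulli n).eval (1 / 2) / n.factorial

section

open PowerSeries

lemma X_mul_derivative_mk_halfBernoulli :
    X * d⁄dX ℚ (PowerSeries.mk halfBernoulli) =
      PowerSeries.mk halfBernoulli * (1 - C (1 / 2) * X - bernoulliPowerSeries ℚ) := by
  set A := PowerSeries.mk halfBernoulli
  set B := bernoulliPowerSeries ℚ
  set E := rescale (1 / 2 : ℚ) (exp ℚ) with hE
  have hA : A * (exp ℚ - 1) = X * E := by
    rw [hE, ← Polynomial.bernoulli_generating_function (1 / 2 : ℚ)]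
    congr 1
    ext n
    simp [A, halfBernoulli, Polynomial.aeval_def, Polynomial.eval₂_eq_eval_map, div_eq_inv_mul]
  have hB : B * (exp ℚ - 1) = X := bernoulliPowerSeries_mul_exp_sub_one ℚ
  have hexp : d⁄dX ℚ (exp ℚ) = exp ℚ := by
    ext n
    rw [coeff_derivative, coeff_exp, coeff_exp, Nat.factorial_succ]
    simp
    field_simp
  have hE' : d⁄dX ℚ E = C (1 / 2) * E := by
    ext n
    rw [coeff_derivative, coeff_C_mul, coeff_rescale, coeff_rescale, coeff_exp, coeff_exp,
      Nat.factorial_succ]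
    simp
    field_simp
    ring
  have hne : exp ℚ - 1 ≠ 0 := by
    intro h
    have := congrArg (coeff 1) h
    simp [coeff_exp, coeff_one] at this
  have hd := congrArg (d⁄dX ℚ) hA
  simp only [Derivation.leibniz, smul_eq_mul, map_sub, derivative_one, derivative_X, hexp,
    hE'] at hd
  have hC : C (1 / 2 : ℚ) * 2 = 1 := by
    rw [← map_ofNat (C : ℚ →+* ℚ⟦X⟧) 2, ← map_mul]
    norm_num
  refine mul_right_cancel₀ hne ?_
  linear_combination X * hd - (1 + C (1 / 2) * X) * hA + A * hB + A * X * (exp ℚ - 1) * hC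

lemma two_mul_succ_mul_halfBernoulli (n : ℕ) :
    2 * (n + 1) * halfBernoulli (2 * (n + 1)) =
      -∑ p ∈ antidiagonal n,
        halfBernoulli (2 * p.1) * (bernoulli (2 * (p.2 + 1)) / (2 * (p.2 + 1)).factorial) := by
  have h := congrArg (coeff (2 * n + 1 + 1)) X_mul_derivative_mk_halfBernoulli
  rw [coeff_succ_X_mul, coeff_derivative, coeff_mul] at h
  rw [← sum_neg_distrib]
  simp only [coeff_mk] at h
  push_cast at h
  rw [mul_add 2 n 1, mul_one]
  refine Eq.trans ?_ (h.trans (Eq.symm ?_))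
  · ring
  refine sum_of_injOn (fun p : ℕ × ℕ => (2 * p.1, 2 * (p.2 + 1))) ?_ ?_ ?_ ?_
  · rintro ⟨a, b⟩ _ ⟨c, d⟩ _ h
    simp only [Prod.mk.injEq] at h ⊢
    omega
  · rintro ⟨a, b⟩ h
    simp only [mem_coe, HasAntidiagonal.mem_antidiagonal] at h ⊢
    omega
  · rintro ⟨a, b⟩ hab hn
    rw [HasAntidiagonal.mem_antidiagonal] at hab
    dsimp only at hab ⊢
    refine mul_eq_zero_of_right _ ?_
    obtain hb | hb := Nat.even_or_odd b
    · obtain ⟨c, rfl⟩ := hb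
      cases c with
      | zero => simp [bernoulliPowerSeries]
      | succ c =>
        refine absurd ⟨(n - c, c), ?_, ?_⟩ hn
        · simp only [mem_coe, HasAntidiagonal.mem_antidiagonal]
          omega
        · ext <;> dsimp only <;> omega
    · obtain rfl | hb1 := eq_or_ne b 1
      · simp [bernoulliPowerSeries, coeff_one]
        norm_num
      · have : 1 < b := by
          obtain ⟨c, rfl⟩ := hb
          omega
        simp [bernoulliPowerSeries, coeff_one, coeff_X, bernoulli_eq_zero_of_odd hb this, hb1,
          (zero_lt_one.trans this).ne']
  · rintro ⟨a, b⟩ _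
    have h1 : 2 * (b + 1) ≠ 1 := by omega
    simp [bernoulliPowerSeries, coeff_one, coeff_X, h1]

end

lemma tendsto_coeff_completeSeries (n : ℕ) :
    Tendsto (fun N => PowerSeries.coeff n
        (PowerSeries.completeSeries (fun k : ℕ => 1 / (k : ℝ) ^ 2) N)) atTop
      (𝓝 ((-1) ^ n * (2 * π) ^ (2 * n) * halfBernoulli (2 * n))) := by
  induction n using Nat.strong_induction_on with
  | _ n ih =>
  cases n with
  | zero => simp [PowerSeries.completeSeries, map_prod, halfBernoulli]
  | succ n =>
    have hpow (j : ℕ) : Tendsto (fun N => ∑ k ∈ Icc 1 N, (1 / ((k : ℕ) : ℝ) ^ 2) ^ (j + 1))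
        atTop
        (𝓝 ((-1 : ℝ) ^ (j + 1 + 1) * (2 : ℝ) ^ (2 * (j + 1) - 1) * π ^ (2 * (j + 1)) *
          bernoulli (2 * (j + 1)) / (2 * (j + 1)).factorial)) := by
      have := (hasSum_zeta_nat (k := j + 1) (by omega)).tendsto_sum_nat.comp (tendsto_add_atTop_nat 1)
      refine this.congr fun N => ?_
      simp only [Function.comp_apply]
      rw [sum_range_succ', range_eq_Ico, sum_Ico_add' (fun k : ℕ => 1 / (k : ℝ) ^ (2 * (j + 1)))]
      simp only [Nat.cast_zero]
      rw [zero_pow (by omega), div_zero, add_zero]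
      refine sum_congr (by ext; simp) fun k _ => ?_
      rw [div_pow, one_pow, pow_mul]
    have hsum := tendsto_finsetSum (antidiagonal n) fun p hp =>
      (ih p.1 (by rw [HasAntidiagonal.mem_antidiagonal] at hp; omega)).mul (hpow p.2)
    have hdiv := hsum.const_mul ((n : ℝ) + 1)⁻¹
    have hn : (n : ℝ) + 1 ≠ 0 := by positivity
    convert! hdiv using 1
    · ext N
      rw [← PowerSeries.succ_mul_coeff_completeSeries, inv_mul_cancel_left₀ hn]
    · congr 1
      rw [eq_inv_mul_iff_mul_eq₀ hn]
      have h := congrArg (Rat.cast : ℚ → ℝ) (two_mul_succ_mul_halfBernoulli n)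
      push_cast at h
      have key : ((n : ℝ) + 1) *
          ((-1) ^ (n + 1) * (2 * π) ^ (2 * (n + 1)) * halfBernoulli (2 * (n + 1))) =
          (-1) ^ (n + 1) * (2 * π) ^ (2 * (n + 1)) / 2 *
            (2 * (n + 1) * halfBernoulli (2 * (n + 1))) := by ring
      rw [key, h, ← sum_neg_distrib, mul_sum]
      refine sum_congr rfl fun p hp => ?_
      rw [HasAntidiagonal.mem_antidiagonal] at hp
      have h2 : 2 * (p.2 + 1) - 1 = 2 * p.2 + 1 := by omega
      rw [← hp, h2]
      have h4 : ((-1 : ℝ) ^ p.2) * (-1) ^ p.2 = 1 := by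
        rw [← mul_pow]
        norm_num
      ring

/-- The truncations of `ζ⋆({2m}^n)` converge to an expression in the coefficients of
`t e^{t/2} / (e^t - 1)`. -/
lemma tendsto_sum_monotoneTuples {m : ℕ} (hm : Even m) (hm0 : 0 < m) (n : ℕ) :
    Tendsto (fun N => ((∑ f ∈ monotoneTuples n N, ∏ i, (1 / (f i : ℝ) ^ 2) ^ m : ℝ) : ℂ)) atTop
      (𝓝 ((2 * π) ^ (2 * m * n) * ∑ p ∈ Finset.Nat.antidiagonalTuple m (m * n),
        (∏ j, (halfBernoulli (2 * p j) : ℂ)) *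
          Complex.exp (2 * π * Complex.I / m) ^ (∑ j : Fin m, (j : ℕ) * p j))) := by
  have hζ := Complex.isPrimitiveRoot_exp m hm0.ne'
  have hcast (q N : ℕ) : PowerSeries.coeff q
      (PowerSeries.completeSeries (fun k : ℕ => ((1 / (k : ℝ) ^ 2 : ℝ) : ℂ)) N) =
      ((PowerSeries.coeff q
        (PowerSeries.completeSeries (fun k : ℕ => 1 / (k : ℝ) ^ 2) N) : ℝ) : ℂ) := by
    simp only [PowerSeries.coeff_completeSeries]
    push_cast
    rfl
  have hlim (q : ℕ) := (tendsto_coeff_completeSeries q).ofReal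
  have htend := tendsto_finsetSum (Finset.Nat.antidiagonalTuple m (m * n)) fun p _ =>
    (tendsto_finsetProd univ fun j _ => hlim (p j)).mul_const
      (Complex.exp (2 * π * Complex.I / m) ^ (∑ j : Fin m, (j : ℕ) * p j))
  convert! htend using 1
  · ext N
    have h := PowerSeries.coeff_completeSeries_pow hζ hm0
      (fun k : ℕ => ((1 / (k : ℝ) ^ 2 : ℝ) : ℂ)) n N
    simp only [hcast] at h
    rw [PowerSeries.coeff_completeSeries] at h
    exact_mod_cast h
  · congr 1
    rw [mul_sum]
    refine sum_congr rfl fun p hp => ?_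
    rw [Finset.Nat.mem_antidiagonalTuple] at hp
    push_cast
    rw [prod_mul_distrib, prod_mul_distrib, prod_pow_eq_pow_sum, prod_pow_eq_pow_sum, ← mul_sum,
      hp, (hm.mul_right n).neg_one_pow]
    ring

/-- For even positive `m`,
`ζ⋆({2m}^n) = (2π)^{2mn} Σ_{p₁+⋯+p_m = mn} (Π_j B_{2p_j}(1/2)/(2p_j)!) ·
  exp((2πi/m) Σ_ℓ (ℓ-1) p_ℓ)`. -/
theorem zeta_star_two_m_rep_even (m n : ℕ) (hm : Even m) (hm0 : 0 < m) (hn : 1 ≤ n) :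
    (mzsv (fun _ : Fin n => ((2 * m : ℕ) : ℝ)) : ℂ) =
      (2 * π) ^ (2 * m * n) *
        ∑ p ∈ Finset.Nat.antidiagonalTuple m (m * n),
          (∏ j : Fin m,
            (((Polynomial.bernoulli (2 * p j)).eval ((1 : ℚ) / 2) : ℚ) : ℂ) /
              (Nat.factorial (2 * p j))) *
          Complex.exp (2 * π * Complex.I / m * ((∑ j : Fin m, (j : ℕ) * p j : ℕ) : ℂ)) := by
  have htend := tendsto_sum_monotoneTuples hm hm0 n
  have hre := (Complex.continuous_re.tendsto _).comp htend
  simp only [Function.comp_def, Complex.ofReal_re] at hre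
  have hsum := hasSum_monotone_of_tendsto (x := fun k : ℕ => (1 / (k : ℝ) ^ 2) ^ m)
    (fun k => by positivity) hre
  have hmzsv : mzsv (fun _ : Fin n => ((2 * m : ℕ) : ℝ)) =
      ∑' f : {f : Fin n → ℕ // (∀ i, 1 ≤ f i) ∧ Monotone f},
        ∏ i, (1 / (f.1 i : ℝ) ^ 2) ^ m := by
    refine tsum_congr fun f => prod_congr rfl fun i _ => ?_
    rw [Real.rpow_neg (Nat.cast_nonneg _), Real.rpow_natCast, pow_mul, div_pow, one_pow, one_div]
  rw [hmzsv, hsum.tsum_eq, ← tendsto_nhds_unique htend hre.ofReal]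
  congr 1
  refine sum_congr rfl fun p _ => ?_
  rw [← Complex.exp_nat_mul, mul_comm _ (2 * (π : ℂ) * Complex.I / m)]
  simp only [halfBernoulli]
  push_cast
  rfl
end

section
/- Let m ≥ 3 be an odd positive integer and n a positive integer. Then ζ⋆({2m}^n) = (2πi)^{2mn} · Σ_{p₁+p₂+⋯+p_m = 2mn, pⱼ≥0} ( Π_{j=1}^{m} B_{pⱼ} / pⱼ! ) · exp( (2πi/m) · Σ_{ℓ=1}^{m} (ℓ−1) p_ℓ ), where B_j denotes the j-th Bernoulli number. -/
open Real Finset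

open Filter Topology

/-- The complete homogeneous symmetric sum of degree `n` in `a 1, …, a N`. -/
noncomputable def completeSum (a : ℕ → ℝ) (n N : ℕ) : ℝ :=
  ∑ f ∈ (Fintype.piFinset fun _ : Fin n => Icc 1 N).filter Monotone, ∏ i, a (f i)

lemma monotone_snoc_iff {n : ℕ} (g : Fin n → ℕ) (k : ℕ) :
    Monotone (Fin.snoc (α := fun _ => ℕ) g k : Fin (n + 1) → ℕ) ↔ Monotone g ∧ ∀ i, g i ≤ k := by
  constructor
  · intro h
    refine ⟨fun i j hij => ?_, fun i => ?_⟩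
    · simpa using h (Fin.castSucc_le_castSucc_iff.2 hij)
    · simpa using h (Fin.le_last i.castSucc)
  · rintro ⟨hg, hk⟩ i j hij
    induction i using Fin.lastCases with
    | last => simp [Fin.last_le_iff.1 hij]
    | cast i =>
      induction j using Fin.lastCases with
      | last => simpa using hk i
      | cast j => simpa using hg (Fin.castSucc_le_castSucc_iff.1 hij)

lemma completeSum_zero_left (a : ℕ → ℝ) (N : ℕ) : completeSum a 0 N = 1 := by
  simp [completeSum, Subsingleton.monotone]

lemma completeSum_succ (a : ℕ → ℝ) (n N : ℕ) :
    completeSum a (n + 1) N = ∑ k ∈ Icc 1 N, a k * completeSum a n k := by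
  simp_rw [completeSum, mul_sum]
  rw [Finset.sum_sigma']
  refine Finset.sum_bij' (fun f _ => ⟨f (Fin.last n), Fin.init f⟩)
    (fun p _ => Fin.snoc (α := fun _ => ℕ) p.2 p.1) ?_ ?_ ?_ ?_ ?_
  · intro f hf
    rw [mem_filter, Fintype.mem_piFinset] at hf
    simp only [mem_sigma, mem_filter, Fintype.mem_piFinset]
    refine ⟨hf.1 _, fun i => ?_, fun i j hij => hf.2 (Fin.castSucc_le_castSucc_iff.2 hij)⟩
    exact mem_Icc.2 ⟨(mem_Icc.1 (hf.1 _)).1, hf.2 (Fin.le_last _)⟩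
  · rintro ⟨k, g⟩ h
    simp only [mem_sigma, mem_filter, Fintype.mem_piFinset, mem_Icc] at h ⊢
    obtain ⟨hk, hg, hm⟩ := h
    refine ⟨fun i => ?_, (monotone_snoc_iff g k).2 ⟨hm, fun i => (hg i).2⟩⟩
    induction i using Fin.lastCases with
    | last => simpa using hk
    | cast i => simpa using ⟨(hg i).1, (hg i).2.trans hk.2⟩
  · intro f _
    exact Fin.snoc_init_self f
  · rintro ⟨k, g⟩ _
    simp
  · intro f _
    rw [Fin.prod_univ_castSucc, mul_comm]
    rfl

lemma completeSum_succ_succ (a : ℕ → ℝ) (n N : ℕ) :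
    completeSum a (n + 1) (N + 1) =
      completeSum a (n + 1) N + a (N + 1) * completeSum a n (N + 1) := by
  rw [completeSum_succ, completeSum_succ, sum_Icc_succ_top (by omega)]

lemma completeSum_nonneg {a : ℕ → ℝ} (ha : ∀ k, 0 ≤ a k) (n N : ℕ) : 0 ≤ completeSum a n N :=
  sum_nonneg fun _ _ => prod_nonneg fun _ _ => ha _

lemma completeSum_le {a : ℕ → ℝ} (ha : ∀ k, 0 ≤ a k) (hs : Summable a) (n N : ℕ) :
    completeSum a n N ≤ (∑' k, a k) ^ n := by
  induction n generalizing N with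
  | zero => simp [completeSum_zero_left]
  | succ n ih =>
    rw [completeSum_succ, pow_succ']
    calc ∑ k ∈ Icc 1 N, a k * completeSum a n k
        ≤ ∑ k ∈ Icc 1 N, a k * (∑' k, a k) ^ n :=
          sum_le_sum fun k _ => mul_le_mul_of_nonneg_left (ih k) (ha k)
      _ = (∑ k ∈ Icc 1 N, a k) * (∑' k, a k) ^ n := by rw [sum_mul]
      _ ≤ _ := mul_le_mul_of_nonneg_right (hs.sum_le_tsum _ fun k _ => ha k)
          (pow_nonneg (tsum_nonneg ha) n)

lemma tendsto_completeSum {a : ℕ → ℝ} (ha : ∀ k, 0 ≤ a k) (hs : Summable a) (n : ℕ) :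
    Tendsto (completeSum a n) atTop
      (𝓝 (∑' f : {f : Fin n → ℕ // (∀ i, 1 ≤ f i) ∧ Monotone f}, ∏ i, a (f.1 i))) := by
  classical
  set P : (Fin n → ℕ) → Prop := fun f => (∀ i, 1 ≤ f i) ∧ Monotone f with hP
  let S : ℕ → Finset {f // P f} := fun N =>
    (Fintype.piFinset fun _ : Fin n => Icc 1 N).subtype P
  have hS : ∀ N, ∑ f ∈ S N, ∏ i, a (f.1 i) = completeSum a n N := by
    intro N
    rw [completeSum, Finset.sum_subtype_eq_sum_filter (f := fun f : Fin n → ℕ => ∏ i, a (f i))]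
    refine sum_congr (filter_congr fun f hf => ?_) fun _ _ => rfl
    rw [Fintype.mem_piFinset] at hf
    exact ⟨fun h => h.2, fun h => ⟨fun i => (mem_Icc.1 (hf i)).1, h⟩⟩
  have hmono : Monotone S := by
    intro N M h f hf
    simp only [S, mem_subtype, Fintype.mem_piFinset, mem_Icc] at hf ⊢
    exact fun i => ⟨(hf i).1, (hf i).2.trans h⟩
  have hmem : ∀ f : {f // P f}, ∃ N, f ∈ S N := by
    intro f
    refine ⟨∑ i, f.1 i, ?_⟩
    simp only [S, mem_subtype, Fintype.mem_piFinset, mem_Icc]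
    exact fun i => ⟨f.2.1 i, single_le_sum (f := f.1) (fun _ _ => Nat.zero_le _) (mem_univ i)⟩
  have hlim := tendsto_atTop_finset_of_monotone hmono hmem
  have hsum : Summable fun f : {f // P f} => ∏ i, a (f.1 i) := by
    refine summable_of_sum_le (c := (∑' k, a k) ^ n) (fun f => prod_nonneg fun _ _ => ha _)
      fun u => ?_
    obtain ⟨N, hN⟩ := (hlim.eventually (eventually_ge_atTop u)).exists
    calc _ ≤ ∑ f ∈ S N, ∏ i, a (f.1 i) :=
          sum_le_sum_of_subset_of_nonneg hN fun f _ _ => prod_nonneg fun _ _ => ha _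
      _ ≤ _ := (hS N).trans_le (completeSum_le ha hs n N)
  have := hsum.hasSum.comp hlim
  exact this.congr hS

lemma norm_completeSum_mul_pow_le {a : ℕ → ℝ} (ha : ∀ k, 0 ≤ a k) (hs : Summable a) (y : ℂ)
    (n N : ℕ) : ‖(completeSum a n N : ℂ) * y ^ n‖ ≤ ((∑' k, a k) * ‖y‖) ^ n := by
  rw [norm_mul, norm_pow, Complex.norm_real, Real.norm_of_nonneg (completeSum_nonneg ha n N),
    mul_pow]
  exact mul_le_mul_of_nonneg_right (completeSum_le ha hs n N) (by positivity)

lemma tsum_completeSum_mul_prod {a : ℕ → ℝ} (ha : ∀ k, 0 ≤ a k) (hs : Summable a) {y : ℂ}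
    (hy : (∑' k, a k) * ‖y‖ < 1) (N : ℕ) :
    (∑' n, (completeSum a n N : ℂ) * y ^ n) * ∏ k ∈ range N, (1 - a (k + 1) * y) = 1 := by
  have hsum : ∀ N, Summable fun n => (completeSum a n N : ℂ) * y ^ n := fun N =>
    Summable.of_norm_bounded
      (summable_geometric_of_lt_one (mul_nonneg (tsum_nonneg ha) (norm_nonneg y)) hy)
      fun n => norm_completeSum_mul_pow_le ha hs y n N
  induction N with
  | zero =>
    rw [(hsum 0).tsum_eq_zero_add]
    simp [completeSum_zero_left, completeSum_succ]
  | succ N ih =>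
    refine Eq.trans ?_ ih
    rw [prod_range_succ]
    have h1 := (hsum (N + 1)).tsum_eq_zero_add
    have h2 := (hsum N).tsum_eq_zero_add
    have h3 : ∑' n, (completeSum a (n + 1) (N + 1) : ℂ) * y ^ (n + 1) =
        ∑' n, (completeSum a (n + 1) N : ℂ) * y ^ (n + 1) +
          a (N + 1) * y * ∑' n, (completeSum a n (N + 1) : ℂ) * y ^ n := by
      rw [← tsum_mul_left, ← Summable.tsum_add ((summable_nat_add_iff 1).2 (hsum N))
        ((hsum (N + 1)).mul_left _)]
      refine tsum_congr fun n => ?_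
      rw [completeSum_succ_succ]
      push_cast
      ring
    simp only [completeSum_zero_left] at h1 h2
    linear_combination (∏ k ∈ range N, (1 - a (k + 1) * y)) * (h1 - h2 + h3)

lemma tsum_mul_eq_one_of_tendsto {a : ℕ → ℝ} (ha : ∀ k, 0 ≤ a k) (hs : Summable a) {h : ℕ → ℝ}
    (hh : ∀ n, Tendsto (completeSum a n) atTop (𝓝 (h n))) {y P : ℂ}
    (hy : (∑' k, a k) * ‖y‖ < 1)
    (hP : Tendsto (fun N => ∏ k ∈ range N, (1 - a (k + 1) * y)) atTop (𝓝 P)) :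
    Summable (fun n => (h n : ℂ) * y ^ n) ∧ (∑' n, (h n : ℂ) * y ^ n) * P = 1 := by
  have hg : Summable fun n => ((∑' k, a k) * ‖y‖) ^ n :=
    summable_geometric_of_lt_one (mul_nonneg (tsum_nonneg ha) (norm_nonneg y)) hy
  have hlim : ∀ n, Tendsto (fun N => (completeSum a n N : ℂ) * y ^ n) atTop
      (𝓝 ((h n : ℂ) * y ^ n)) := fun n =>
    ((Complex.continuous_ofReal.tendsto _).comp (hh n)).mul_const _
  refine ⟨Summable.of_norm_bounded hg fun n => le_of_tendsto (hlim n).norm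
    (Eventually.of_forall fun N => norm_completeSum_mul_pow_le ha hs y n N), ?_⟩
  have ht := tendsto_tsum_of_dominated_convergence hg hlim
    (Eventually.of_forall fun N n => norm_completeSum_mul_pow_le ha hs y n N)
  refine tendsto_nhds_unique ((ht.mul hP).congr fun N => ?_) tendsto_const_nhds
  exact tsum_completeSum_mul_prod ha hs hy N

lemma prod_one_sub_primitiveRoot_pow_mul {m : ℕ} (hm : 0 < m) {ζ : ℂ} (hζ : IsPrimitiveRoot ζ m)
    (z : ℂ) : ∏ j : Fin m, (1 - ζ ^ (j : ℕ) * z) = 1 - z ^ m := by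
  have h := hζ.pow_sub_pow_eq_prod_sub_mul (x := 1) (y := z) hm
  rw [one_pow] at h
  rw [h, Fin.prod_univ_eq_prod_range (fun j => 1 - ζ ^ j * z) m]
  refine prod_nbij (fun j => ζ ^ j) (fun j _ => ?_) hζ.injOn_pow ?_ fun _ _ => rfl
  · rw [Polynomial.mem_nthRootsFinset hm, ← pow_mul, mul_comm, pow_mul, hζ.pow_eq_one, one_pow]
  · intro μ hμ
    rw [mem_coe, Polynomial.mem_nthRootsFinset hm] at hμ
    have : NeZero m := ⟨hm.ne'⟩
    obtain ⟨i, hi, rfl⟩ := hζ.eq_pow_of_pow_eq_one hμ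
    exact ⟨i, by simpa using hi, rfl⟩

lemma tendsto_prod_sin {m : ℕ} (hm : Odd m) {ω : ℂ} (hω : IsPrimitiveRoot ω m) (x : ℂ) :
    Tendsto (fun N : ℕ => (∏ j : Fin m, (π * (ω ^ (j : ℕ) * x))) *
        ∏ k ∈ range N, (1 - x ^ (2 * m) / ((k : ℂ) + 1) ^ (2 * m))) atTop
      (𝓝 (∏ j : Fin m, Complex.sin (π * (ω ^ (j : ℕ) * x)))) := by
  refine (tendsto_finsetProd univ fun (j : Fin m) _ =>
    Complex.tendsto_euler_sin_prod (ω ^ (j : ℕ) * x)).congr fun N => ?_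
  rw [prod_mul_distrib, Finset.prod_comm]
  congr 1
  refine prod_congr rfl fun k _ => ?_
  have hω2 : IsPrimitiveRoot (ω ^ 2) m :=
    hω.pow_of_coprime 2 (Nat.coprime_two_left.2 hm)
  have := prod_one_sub_primitiveRoot_pow_mul hm.pos hω2 (x ^ 2 / ((k : ℂ) + 1) ^ 2)
  rw [div_pow, ← pow_mul, ← pow_mul] at this
  rw [← this]
  refine prod_congr rfl fun j _ => ?_
  ring

lemma exp_two_mul_I_sub_one (z : ℂ) :
    Complex.exp (2 * Complex.I * z) - 1 =
      Complex.exp (Complex.I * z) * (2 * Complex.I * Complex.sin z) := by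
  rw [Complex.sin, mul_assoc 2, two_mul, Complex.exp_add]
  have h : Complex.exp (Complex.I * z) * Complex.exp (-z * Complex.I) = 1 := by
    rw [← Complex.exp_add]
    simp [mul_comm]
  rw [mul_comm z Complex.I]
  linear_combination h - Complex.exp (Complex.I * z) *
    (Complex.exp (-z * Complex.I) - Complex.exp (Complex.I * z)) * Complex.I_sq

lemma prod_exp_sub_one {m : ℕ} (hm : 1 < m) {ω : ℂ} (hω : IsPrimitiveRoot ω m) (x : ℂ) :
    ∏ j : Fin m, (Complex.exp (2 * π * Complex.I * ω ^ (j : ℕ) * x) - 1) =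
      (2 * Complex.I) ^ m * ∏ j : Fin m, Complex.sin (π * (ω ^ (j : ℕ) * x)) := by
  have h : ∀ j : Fin m, Complex.exp (2 * π * Complex.I * ω ^ (j : ℕ) * x) - 1 =
      Complex.exp (Complex.I * (π * (ω ^ (j : ℕ) * x))) *
        (2 * Complex.I * Complex.sin (π * (ω ^ (j : ℕ) * x))) := fun j => by
    rw [← exp_two_mul_I_sub_one]
    congr 2
    ring
  simp_rw [h]
  have h0 : ∑ j : Fin m, Complex.I * (π * (ω ^ (j : ℕ) * x)) = 0 := by
    rw [← mul_sum, ← mul_sum, ← sum_mul, Fin.sum_univ_eq_sum_range (fun j => ω ^ j) m,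
      hω.geom_sum_eq_zero hm]
    simp
  rw [prod_mul_distrib, ← Complex.exp_sum, h0, Complex.exp_zero, one_mul, prod_mul_distrib]
  simp

lemma summable_rpow_neg_two_mul {m : ℕ} (hm : 1 ≤ m) :
    Summable fun k : ℕ => (k : ℝ) ^ (-((2 * m : ℕ) : ℝ)) := by
  rw [Real.summable_nat_rpow]
  have : (1 : ℝ) ≤ m := by exact_mod_cast hm
  push_cast
  linarith

/-- The generating function of `ζ⋆({2m}ⁿ)` is a product of reciprocals of sines. -/
lemma eventually_prod_exp_sub_one_mul_tsum {m : ℕ} (hm : 3 ≤ m) (hmo : Odd m) {ω : ℂ}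
    (hω : IsPrimitiveRoot ω m) :
    ∀ᶠ x : ℂ in 𝓝 0,
      Summable (fun n : ℕ =>
        (mzsv (fun _ : Fin n => ((2 * m : ℕ) : ℝ)) : ℂ) * (x ^ (2 * m)) ^ n) ∧
      (∑' n : ℕ, (mzsv (fun _ : Fin n => ((2 * m : ℕ) : ℝ)) : ℂ) * (x ^ (2 * m)) ^ n) *
        ∏ j : Fin m, (Complex.exp (2 * π * Complex.I * ω ^ (j : ℕ) * x) - 1) =
        ∏ j : Fin m, (2 * π * Complex.I * ω ^ (j : ℕ) * x) := by
  set a : ℕ → ℝ := fun k => (k : ℝ) ^ (-((2 * m : ℕ) : ℝ)) with ha_def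
  have ha : ∀ k, 0 ≤ a k := fun k => Real.rpow_nonneg (Nat.cast_nonneg k) _
  have hs : Summable a := summable_rpow_neg_two_mul (by omega)
  have hh : ∀ n, Tendsto (completeSum a n) atTop
      (𝓝 (mzsv (fun _ : Fin n => ((2 * m : ℕ) : ℝ)))) := fun n => tendsto_completeSum ha hs n
  have hak : ∀ (k : ℕ) (y : ℂ), y / ((k : ℂ) + 1) ^ (2 * m) = a (k + 1) * y := by
    intro k y
    rw [ha_def]
    simp only
    rw [Real.rpow_neg (by positivity), Real.rpow_natCast]
    push_cast
    rw [div_eq_inv_mul]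
  have hcont : Tendsto (fun x : ℂ => (∑' k, a k) * ‖x ^ (2 * m)‖) (𝓝 0) (𝓝 0) := by
    have : Continuous fun x : ℂ => (∑' k, a k) * ‖x ^ (2 * m)‖ := by fun_prop
    have h := this.tendsto 0
    rwa [zero_pow (by omega), norm_zero, mul_zero] at h
  filter_upwards [hcont.eventually (gt_mem_nhds one_pos)] with x hx
  have hω0 : ω ≠ 0 := hω.ne_zero (by omega)
  rcases eq_or_ne x 0 with rfl | hx0
  · refine ⟨?_, ?_⟩
    · refine summable_of_ne_finset_zero (s := {0}) fun n hn => ?_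
      rw [zero_pow (by omega), zero_pow (by simpa using hn), mul_zero]
    · have hm0 : m ≠ 0 := by omega
      simp [hm0]
  · set D := ∏ j : Fin m, ((π : ℂ) * (ω ^ (j : ℕ) * x)) with hD
    have hD0 : D ≠ 0 := prod_ne_zero_iff.2 fun j _ =>
      mul_ne_zero (by exact_mod_cast Real.pi_ne_zero) (mul_ne_zero (pow_ne_zero _ hω0) hx0)
    have hP := (tendsto_prod_sin hmo hω x).const_mul D⁻¹
    have hP' : Tendsto (fun N => ∏ k ∈ range N, (1 - a (k + 1) * x ^ (2 * m))) atTop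
        (𝓝 (D⁻¹ * ∏ j : Fin m, Complex.sin (π * (ω ^ (j : ℕ) * x)))) := by
      refine hP.congr fun N => ?_
      rw [inv_mul_cancel_left₀ hD0]
      simp_rw [hak]
    obtain ⟨h1, h2⟩ := tsum_mul_eq_one_of_tendsto ha hs hh hx hP'
    refine ⟨h1, ?_⟩
    have hD2 : ∏ j : Fin m, (2 * π * Complex.I * ω ^ (j : ℕ) * x) = (2 * Complex.I) ^ m * D := by
      rw [hD]
      conv_rhs => rw [← Fin.prod_const, ← prod_mul_distrib]
      exact prod_congr rfl fun j _ => by ring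
    rw [prod_exp_sub_one (by omega) hω, hD2]
    have hDD : D * D⁻¹ = 1 := mul_inv_cancel₀ hD0
    set S := ∏ j : Fin m, Complex.sin (π * (ω ^ (j : ℕ) * x))
    set H := ∑' n : ℕ, (mzsv (fun _ : Fin n => ((2 * m : ℕ) : ℝ)) : ℂ) * (x ^ (2 * m)) ^ n
    linear_combination (2 * Complex.I) ^ m * D * h2 - (2 * Complex.I) ^ m * H * S * hDD

/-- The power series `F` converges to `f` on a neighbourhood of `0`. -/
def SumsTo (F : PowerSeries ℂ) (f : ℂ → ℂ) : Prop :=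
  ∀ᶠ x in 𝓝 (0 : ℂ), HasSum (fun n => PowerSeries.coeff n F * x ^ n) (f x)

lemma SumsTo.mul {F G : PowerSeries ℂ} {f g : ℂ → ℂ} (hF : SumsTo F f) (hG : SumsTo G g) :
    SumsTo (F * G) fun x => f x * g x := by
  filter_upwards [hF, hG] with x hf hg
  have hfn := hf.summable.norm
  have hgn := hg.summable.norm
  have hsum := (summable_norm_sum_mul_antidiagonal_of_summable_norm hfn hgn).of_norm
  have heq := tsum_mul_tsum_eq_tsum_sum_antidiagonal_of_summable_norm hfn hgn
  rw [hf.tsum_eq, hg.tsum_eq] at heq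
  rw [heq]
  convert! hsum.hasSum using 2 with n
  rw [PowerSeries.coeff_mul, sum_mul]
  refine sum_congr rfl fun p hp => ?_
  rw [← mem_antidiagonal.1 hp, pow_add]
  ring

lemma SumsTo.prod {ι : Type*} (s : Finset ι) {F : ι → PowerSeries ℂ} {f : ι → ℂ → ℂ}
    (h : ∀ i ∈ s, SumsTo (F i) (f i)) : SumsTo (∏ i ∈ s, F i) fun x => ∏ i ∈ s, f i x := by
  classical
  induction s using Finset.induction_on with
  | empty =>
    refine Eventually.of_forall fun x => ?_
    have h := hasSum_single (f := fun n => PowerSeries.coeff n (1 : PowerSeries ℂ) * x ^ n) 0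
      fun n hn => by simp [PowerSeries.coeff_one, hn]
    simpa using h
  | insert i s hi ih =>
    simp_rw [prod_insert hi]
    exact (h i (mem_insert_self i s)).mul (ih fun j hj => h j (mem_insert_of_mem hj))

lemma SumsTo.unique {F G : PowerSeries ℂ} {f : ℂ → ℂ} (hF : SumsTo F f) (hG : SumsTo G f) :
    F = G := by
  have key : ∀ {F : PowerSeries ℂ}, SumsTo F f →
      HasFPowerSeriesAt f (FormalMultilinearSeries.ofScalars ℂ fun n => PowerSeries.coeff n F) 0 := by
    intro F hF
    rw [hasFPowerSeriesAt_iff]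
    filter_upwards [hF] with x hx
    simpa [FormalMultilinearSeries.coeff_ofScalars, mul_comm] using hx
  have h := (key hF).eq_formalMultilinearSeries (key hG)
  rw [FormalMultilinearSeries.ofScalars_series_eq_iff] at h
  ext n
  exact congrFun h n

lemma sumsTo_rescale_X (c : ℂ) : SumsTo (PowerSeries.rescale c PowerSeries.X) fun x => c * x := by
  refine Eventually.of_forall fun x => ?_
  have h := hasSum_single
    (f := fun n => PowerSeries.coeff n (PowerSeries.rescale c PowerSeries.X) * x ^ n) 1
    fun n hn => by rw [PowerSeries.coeff_rescale, PowerSeries.coeff_X, if_neg hn]; simp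
  rwa [PowerSeries.coeff_rescale, PowerSeries.coeff_one_X, pow_one, pow_one, mul_one] at h

lemma sumsTo_rescale_exp_sub_one (c : ℂ) :
    SumsTo (PowerSeries.rescale c (PowerSeries.exp ℂ - 1)) fun x => Complex.exp (c * x) - 1 := by
  refine Eventually.of_forall fun x => ?_
  have h1 : HasSum (fun n : ℕ => (c * x) ^ n / (n.factorial : ℂ)) (Complex.exp (c * x)) := by
    rw [Complex.exp_eq_exp_ℂ]
    exact NormedSpace.expSeries_div_hasSum_exp (c * x)
  have h2 : HasSum (fun n : ℕ => if n = 0 then (1 : ℂ) else 0) 1 := hasSum_ite_eq 0 1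
  convert! h1.sub h2 using 2 with n
  rw [PowerSeries.coeff_rescale, map_sub, PowerSeries.coeff_exp, PowerSeries.coeff_one]
  rcases eq_or_ne n 0 with rfl | hn
  · simp
  · simp [hn, mul_pow]
    ring

lemma sumsTo_expand {p : ℕ} (hp : p ≠ 0) {F : PowerSeries ℂ} {f : ℂ → ℂ}
    (h : ∀ᶠ x in 𝓝 (0 : ℂ), HasSum (fun n => PowerSeries.coeff n F * (x ^ p) ^ n) (f x)) :
    SumsTo (PowerSeries.expand p hp F) f := by
  filter_upwards [h] with x hx
  have hinj : Function.Injective fun n : ℕ => p * n := fun _ _ h =>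
    Nat.eq_of_mul_eq_mul_left (Nat.pos_of_ne_zero hp) h
  rw [← hinj.hasSum_iff]
  · simpa [Function.comp_def, pow_mul] using hx
  · intro n hn
    rw [PowerSeries.coeff_expand_of_not_dvd p hp, zero_mul]
    rintro ⟨k, rfl⟩
    exact hn ⟨k, rfl⟩

lemma coeff_prod_eq_sum_antidiagonalTuple {m : ℕ} (F : Fin m → PowerSeries ℂ) (d : ℕ) :
    PowerSeries.coeff d (∏ j, F j) =
      ∑ p ∈ Finset.Nat.antidiagonalTuple m d, ∏ j, PowerSeries.coeff (p j) (F j) := by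
  rw [PowerSeries.coeff_prod]
  refine sum_bij' (fun l _ => ⇑l) (fun p _ => Finsupp.equivFunOnFinite.symm p) ?_ ?_ ?_ ?_ ?_
  · intro l hl
    simpa [Finset.Nat.mem_antidiagonalTuple, mem_finsuppAntidiag] using hl
  · intro p hp
    simpa [Finset.Nat.mem_antidiagonalTuple, mem_finsuppAntidiag] using hp
  · intro l _
    ext j
    simp
  · intro p _
    simp
  · intro l _
    rfl

/-- For odd `m ≥ 3`,
`ζ⋆({2m}^n) = (2πi)^{2mn} Σ_{p₁+⋯+p_m = 2mn} (Π_j B_{p_j}/p_j!) ·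
  exp((2πi/m) Σ_ℓ (ℓ-1) p_ℓ)`. -/
theorem zeta_star_two_m_rep_odd (m n : ℕ) (hm : 3 ≤ m) (hmo : Odd m) (hn : 1 ≤ n) :
    (mzsv (fun _ : Fin n => ((2 * m : ℕ) : ℝ)) : ℂ) =
      (2 * π * Complex.I) ^ (2 * m * n) *
        ∑ p ∈ Finset.Nat.antidiagonalTuple m (2 * m * n),
          (∏ j : Fin m, ((bernoulli (p j) : ℚ) : ℂ) / (Nat.factorial (p j))) *
          Complex.exp (2 * π * Complex.I / m * ((∑ j : Fin m, (j : ℕ) * p j : ℕ) : ℂ)) := by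
  set ω : ℂ := Complex.exp (2 * π * Complex.I / m) with hω_def
  have hm0 : m ≠ 0 := by omega
  have hω : IsPrimitiveRoot ω m := Complex.isPrimitiveRoot_exp m hm0
  set c : Fin m → ℂ := fun j => 2 * π * Complex.I * ω ^ (j : ℕ) with hc
  have hc0 : ∀ j, c j ≠ 0 := fun j =>
    mul_ne_zero Complex.two_pi_I_ne_zero (pow_ne_zero _ (hω.ne_zero hm0))
  set H : PowerSeries ℂ :=
    PowerSeries.mk fun k => (mzsv (fun _ : Fin k => ((2 * m : ℕ) : ℝ)) : ℂ) with hH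
  have h2m : 2 * m ≠ 0 := by omega
  have hexp : SumsTo (PowerSeries.expand (2 * m) h2m H *
      ∏ j, PowerSeries.rescale (c j) (PowerSeries.exp ℂ - 1)) fun x => ∏ j, (c j * x) := by
    have hev := eventually_prod_exp_sub_one_mul_tsum hm hmo hω
    have h1 := (sumsTo_expand h2m (F := H) (hev.mono fun x hx => by
      simpa only [hH, PowerSeries.coeff_mk] using hx.1.hasSum)).mul
        (SumsTo.prod univ fun j _ => sumsTo_rescale_exp_sub_one (c j))
    filter_upwards [h1, hev] with x hx hx'
    simp only [hc] at hx ⊢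
    rwa [hx'.2] at hx
  have hX : SumsTo (∏ j, PowerSeries.rescale (c j) PowerSeries.X) fun x => ∏ j, (c j * x) :=
    SumsTo.prod univ fun j _ => sumsTo_rescale_X (c j)
  have hB : (∏ j, PowerSeries.rescale (c j) (bernoulliPowerSeries ℂ)) *
      ∏ j, PowerSeries.rescale (c j) (PowerSeries.exp ℂ - 1) =
        ∏ j, PowerSeries.rescale (c j) PowerSeries.X := by
    rw [← prod_mul_distrib]
    refine prod_congr rfl fun j _ => ?_
    rw [← map_mul, bernoulliPowerSeries_mul_exp_sub_one]
  have hX0 : ∏ j, PowerSeries.rescale (c j) (PowerSeries.X : PowerSeries ℂ) ≠ 0 := by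
    refine prod_ne_zero_iff.2 fun j _ h => hc0 j ?_
    simpa [PowerSeries.coeff_rescale] using congrArg (PowerSeries.coeff 1) h
  have hE0 : ∏ j, PowerSeries.rescale (c j) (PowerSeries.exp ℂ - 1) ≠ 0 := by
    intro h
    rw [h, mul_zero] at hB
    exact hX0 hB.symm
  have hmain := mul_right_cancel₀ hE0 ((hexp.unique hX).trans hB.symm)
  have hcoeff := congrArg (PowerSeries.coeff (2 * m * n)) hmain
  rw [PowerSeries.coeff_expand_mul, coeff_prod_eq_sum_antidiagonalTuple, hH,
    PowerSeries.coeff_mk] at hcoeff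
  rw [hcoeff, mul_sum]
  refine sum_congr rfl fun p hp => ?_
  rw [Finset.Nat.mem_antidiagonalTuple] at hp
  have hω_exp : Complex.exp (2 * π * Complex.I / m * ((∑ j : Fin m, (j : ℕ) * p j : ℕ) : ℂ)) =
      ∏ j : Fin m, (ω ^ (j : ℕ)) ^ p j := by
    rw [mul_comm, Complex.exp_nat_mul, ← prod_pow_eq_pow_sum]
    exact prod_congr rfl fun j _ => pow_mul _ _ _
  rw [hω_exp, ← hp, ← prod_pow_eq_pow_sum, ← prod_mul_distrib, ← prod_mul_distrib]
  refine prod_congr rfl fun j _ => ?_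
  simp only [PowerSeries.coeff_rescale, bernoulliPowerSeries, PowerSeries.coeff_mk, hc, mul_pow]
  simp
  ring
end
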